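/- arXiv:1810.03125 — 11 statements merged into one kernel-verified Lean document; each statement's English description precedes it below -/
import Mathlib

section
/- Every completely symmetric pure state is S-separable: if φ ∈ ℝ^{N²} is a unit vector such that the rank-one matrix ρ = φφᵀ (regarded as an operator on ℝ^N ⊗ ℝ^N) is completely symmetric, then there exists a unit vector x ∈ ℝ^N with ρ = (x xᵀ) ⊗ (x xᵀ), i.e. φ = ±(x ⊗ x). -/
open Matrix
open Kronecker
open scoped BigOperators

/-- A matrix on `ℝ^N ⊗ ℝ^N`, with entries `ρ_{ijkl} = ρ (i,k) (j,l)`, is completely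
symmetric if its entries are invariant under every permutation of the four indices. -/
def CompletelySymmetric {N : ℕ} (ρ : Matrix (Fin N × Fin N) (Fin N × Fin N) ℝ) : Prop :=
  ∀ (π : Equiv.Perm (Fin 4)) (v : Fin 4 → Fin N),
    ρ (v (π 0), v (π 2)) (v (π 1), v (π 3)) = ρ (v 0, v 2) (v 1, v 3)

/-- `ρ` is S-separable if it is a finite sum of terms `(x xᵀ) ⊗ (x xᵀ)`. -/
def SSeparable {N : ℕ} (ρ : Matrix (Fin N × Fin N) (Fin N × Fin N) ℝ) : Prop :=
  ∃ (L : ℕ) (x : Fin L → Fin N → ℝ),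
    ρ = ∑ t, vecMulVec (x t) (x t) ⊗ₖ vecMulVec (x t) (x t)

/-- `ρ` is separable over ℝ if it is a finite sum of terms `(x xᵀ) ⊗ (y yᵀ)`. -/
def SeparableR {N : ℕ} (ρ : Matrix (Fin N × Fin N) (Fin N × Fin N) ℝ) : Prop :=
  ∃ (L : ℕ) (x y : Fin L → Fin N → ℝ),
    ρ = ∑ t, vecMulVec (x t) (x t) ⊗ₖ vecMulVec (y t) (y t)

/-- The reduced matrix `ρ₁`, with `(ρ₁)_{ij} = Σ_k ρ_{ijkk}`. -/
def reducedMat {N : ℕ} (ρ : Matrix (Fin N × Fin N) (Fin N × Fin N) ℝ) :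
    Matrix (Fin N) (Fin N) ℝ :=
  Matrix.of fun i j => ∑ k, ρ (i, k) (j, k)

/-- `ρ` is G-invariant if it equals its partial transpose
`ρ^{T₁}((i,k),(j,l)) = ρ((j,k),(i,l))`. -/
def GInvariant {N : ℕ} (ρ : Matrix (Fin N × Fin N) (Fin N × Fin N) ℝ) : Prop :=
  ∀ i j k l, ρ (i, k) (j, l) = ρ (j, k) (i, l)

/-- The column space of a matrix, as a submodule. -/
def colSpace {n : Type*} [Fintype n] [DecidableEq n] (M : Matrix n n ℝ) :
    Submodule ℝ (n → ℝ) :=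
  LinearMap.range (Matrix.toLin' M)

/-- `ρ` is reducible if it splits as `σ + δ` with `σ, δ` nonzero positive semidefinite and
the column space of `ρ₁` the direct sum of the column spaces of `σ₁` and `δ₁`. -/
def Reducible {N : ℕ} (ρ : Matrix (Fin N × Fin N) (Fin N × Fin N) ℝ) : Prop :=
  ∃ σ δ : Matrix (Fin N × Fin N) (Fin N × Fin N) ℝ,
    σ.PosSemidef ∧ δ.PosSemidef ∧ σ ≠ 0 ∧ δ ≠ 0 ∧ ρ = σ + δ ∧
    colSpace (reducedMat ρ) = colSpace (reducedMat σ) ⊔ colSpace (reducedMat δ) ∧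
    colSpace (reducedMat σ) ⊓ colSpace (reducedMat δ) = ⊥

/-- Swapping the two middle indices of a completely symmetric rank-one matrix. -/
theorem CompletelySymmetric.mul_eq_mul {N : ℕ} {φ : Fin N × Fin N → ℝ}
    (h : CompletelySymmetric (vecMulVec φ φ)) (i k j l : Fin N) :
    φ (i, k) * φ (j, l) = φ (i, j) * φ (k, l) := by
  have := h (Equiv.swap 1 2) ![i, k, j, l]
  simpa [vecMulVec_apply, Equiv.swap_apply_def] using this

/-- Every completely symmetric pure state is S-separable: if `φ` is a unit vector in
`ℝ^{N²}` such that `φφᵀ` is completely symmetric, then `φφᵀ = (x xᵀ) ⊗ (x xᵀ)` for some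
unit vector `x ∈ ℝ^N`. -/
theorem completelySymmetric_pure_sSeparable {N : ℕ} (φ : Fin N × Fin N → ℝ)
    (hφ : ∑ p, φ p ^ 2 = 1) (hcs : CompletelySymmetric (vecMulVec φ φ)) :
    ∃ x : Fin N → ℝ, (∑ i, x i ^ 2 = 1) ∧
      vecMulVec φ φ = vecMulVec x x ⊗ₖ vecMulVec x x := by
  have hswap (i k j l : Fin N) : φ (i, k) * φ (j, l) = φ (i, j) * φ (k, l) :=
    hcs.mul_eq_mul i k j l
  obtain ⟨a, ha⟩ : ∃ a, φ (a, a) ≠ 0 := by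
    by_contra! h
    have hzero (p : Fin N × Fin N) : φ p = 0 := by
      have := hswap p.1 p.2 p.1 p.2
      rw [h, zero_mul] at this
      exact mul_self_eq_zero.mp this
    simp [hzero] at hφ
  set s := √|φ (a, a)| with hs
  have hs4 : s ^ 4 = φ (a, a) ^ 2 := by
    rw [show s ^ 4 = (s ^ 2) ^ 2 by ring, hs, Real.sq_sqrt (abs_nonneg _), sq_abs]
  have hs0 : s ≠ 0 := by positivity
  set x : Fin N → ℝ := fun i => φ (i, a) / s with hx
  have hprod (i k j l : Fin N) : φ (i, k) * φ (j, l) = x i * x j * (x k * x l) := by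
    have hscaled : x i * x j * (x k * x l) * s ^ 4 =
        (φ (i, a) * φ (k, a)) * (φ (j, a) * φ (l, a)) := by
      simp only [hx]
      field_simp
    refine mul_right_cancel₀ (pow_ne_zero 4 hs0) ?_
    rw [hscaled, hs4, hswap i a k a, hswap j a l a]
    ring
  refine ⟨x, ?_, ?_⟩
  · have hsq : (∑ i, x i ^ 2) ^ 2 = 1 := by
      rw [← hφ, sq, Finset.sum_mul_sum, Fintype.sum_prod_type]
      refine Finset.sum_congr rfl fun i _ => Finset.sum_congr rfl fun k _ => ?_
      rw [sq (φ _), hprod]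
      ring
    exact (pow_eq_one_iff_of_nonneg (by positivity) two_ne_zero).mp hsq
  · ext ⟨i, k⟩ ⟨j, l⟩
    exact hprod i k j l
end

section
/- Let ρ be a real positive semidefinite matrix on ℝ² ⊗ ℝ² (a 4×4 matrix) that is G-invariant. Then ρ can be written as a sum of rank(ρ) real pure product states: there exist vectors x_1, …, x_r, y_1, …, y_r ∈ ℝ² with r = rank(ρ) such that ρ = Σ_{t=1}^{r} (x_t x_tᵀ) ⊗ (y_t y_tᵀ). -/
open Matrix
open Kronecker
open scoped BigOperators

/-- A real positive semidefinite matrix is a sum of as many rank-one terms `v vᵀ` as its rank. -/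
theorem Matrix.PosSemidef.exists_eq_sum_vecMulVec_rank {n : Type*} [Fintype n] [DecidableEq n]
    {A : Matrix n n ℝ} (hA : A.PosSemidef) :
    ∃ v : Fin A.rank → n → ℝ, A = ∑ t, vecMulVec (v t) (v t) := by
  have hH := hA.isHermitian
  have hcard : Fintype.card {i // hH.eigenvalues i ≠ 0} = Fintype.card (Fin A.rank) := by
    rw [Fintype.card_fin, hH.rank_eq_card_non_zero_eigs]
  let e := Fintype.equivOfCardEq hcard
  let u : n → n → ℝ := fun i p => √(hH.eigenvalues i) * hH.eigenvectorBasis i p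
  refine ⟨fun t => u (e.symm t), ?_⟩
  rw [e.symm.sum_comp (fun i => vecMulVec (u i) (u i))]
  have hA_sum : A = ∑ i, vecMulVec (u i) (u i) := by
    conv_lhs => rw [hH.spectral_theorem, Unitary.conjStarAlgAut_apply]
    ext p q
    rw [Matrix.mul_apply, Matrix.sum_apply]
    simp only [mul_diagonal, vecMulVec_apply, star_apply,
      Function.comp_apply, Matrix.IsHermitian.eigenvectorUnitary_apply]
    refine Finset.sum_congr rfl fun i _ => ?_
    have hsq := Real.mul_self_sqrt (hA.eigenvalues_nonneg i)
    simp only [u, RCLike.ofReal_real_eq_id, id_eq, star_trivial]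
    linear_combination (-hH.eigenvectorBasis i p * hH.eigenvectorBasis i q) * hsq
  refine hA_sum.trans ?_
  rw [← Finset.sum_subtype (p := fun i => hH.eigenvalues i ≠ 0)
    (Finset.univ.filter fun i => hH.eigenvalues i ≠ 0) (by simp) (fun i => vecMulVec (u i) (u i))]
  refine (Finset.sum_filter_of_ne (p := fun i => hH.eigenvalues i ≠ 0)
    fun i _ hi h => hi ?_).symm
  ext p q
  simp [u, h, vecMulVec_apply]

theorem QuadraticMap.map_smul_add_smul {E : Type*} [AddCommGroup E] [Module ℝ E]
    (Q : QuadraticForm ℝ E) (c s : ℝ) (v w : E) :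
    Q (c • v + s • w) = c ^ 2 * Q v + s ^ 2 * Q w + c * s * QuadraticMap.polar Q v w := by
  rw [QuadraticMap.map_add Q, QuadraticMap.map_smul, QuadraticMap.map_smul,
    QuadraticMap.polar_smul_left, QuadraticMap.polar_smul_right]
  simp only [smul_eq_mul]
  ring

/-- If a quadratic form takes values of opposite sign at `v` and `w`, then it vanishes at the
first vector of some rotation of the pair `(v, w)`. -/
theorem QuadraticMap.exists_rotation_eq_zero {E : Type*} [AddCommGroup E] [Module ℝ E]
    (Q : QuadraticForm ℝ E) {v w : E} (hv : 0 < Q v) (hw : Q w < 0) :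
    ∃ c s : ℝ, c ^ 2 + s ^ 2 = 1 ∧ Q (c • v + s • w) = 0 := by
  let f : ℝ → ℝ := fun θ => Q (Real.cos θ • v + Real.sin θ • w)
  have hf : Continuous f := by
    simp only [f, Q.map_smul_add_smul]
    fun_prop
  have hmem : (0 : ℝ) ∈ Set.Icc (f (Real.pi / 2)) (f 0) := by
    simp [f, hv.le, hw.le]
  obtain ⟨θ, -, hθ⟩ := intermediate_value_Icc' (by positivity) hf.continuousOn hmem
  exact ⟨Real.cos θ, Real.sin θ, Real.cos_sq_add_sin_sq θ, hθ⟩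

theorem QuadraticMap.map_rotation_add_map_rotation {E : Type*} [AddCommGroup E] [Module ℝ E]
    (Q : QuadraticForm ℝ E) {c s : ℝ} (h : c ^ 2 + s ^ 2 = 1) (v w : E) :
    Q (c • v + s • w) + Q (-s • v + c • w) = Q v + Q w := by
  rw [Q.map_smul_add_smul, Q.map_smul_add_smul]
  linear_combination (Q v + Q w) * h

theorem Matrix.vecMulVec_rotation_add_vecMulVec_rotation {n : Type*} {c s : ℝ}
    (h : c ^ 2 + s ^ 2 = 1) (v w : n → ℝ) :
    vecMulVec (c • v + s • w) (c • v + s • w) + vecMulVec (-s • v + c • w) (-s • v + c • w) =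
      vecMulVec v v + vecMulVec w w := by
  ext p q
  simp only [Matrix.add_apply, vecMulVec_apply, Pi.add_apply, Pi.smul_apply, smul_eq_mul]
  linear_combination (v p * v q + w p * w q) * h

/-- A sum of terms `v vᵀ` along which a quadratic form sums to zero can be rewritten as a sum of
equally many such terms at each of which the form vanishes. -/
theorem QuadraticMap.exists_isotropic_sum_vecMulVec_eq {ι n : Type*} [DecidableEq ι]
    (Q : QuadraticForm ℝ (n → ℝ)) (T : Finset ι) (v : ι → n → ℝ) (hv : ∑ t ∈ T, Q (v t) = 0) :
    ∃ w : ι → n → ℝ, (∀ t ∈ T, Q (w t) = 0) ∧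
      ∑ t ∈ T, vecMulVec (w t) (w t) = ∑ t ∈ T, vecMulVec (v t) (v t) := by
  induction T using Finset.strongInduction generalizing v with
  | H T ih =>
    have of_isotropic : ∀ (v : ι → n → ℝ), ∑ t ∈ T, Q (v t) = 0 → ∀ i ∈ T, Q (v i) = 0 →
        ∃ w : ι → n → ℝ, (∀ t ∈ T, Q (w t) = 0) ∧
          ∑ t ∈ T, vecMulVec (w t) (w t) = ∑ t ∈ T, vecMulVec (v t) (v t) := by
      intro v hv i hi hvi
      rw [← Finset.add_sum_erase T _ hi, hvi, zero_add] at hv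
      obtain ⟨w, hw, hsum⟩ := ih _ (Finset.erase_ssubset hi) v hv
      refine ⟨Function.update w i (v i), fun t ht => ?_, ?_⟩
      · rcases eq_or_ne t i with rfl | hti
        · simpa using hvi
        · simpa [hti] using hw t (Finset.mem_erase.2 ⟨hti, ht⟩)
      · rw [← Finset.add_sum_erase T _ hi, ← Finset.add_sum_erase T _ hi, ← hsum,
          Function.update_self]
        congr 1
        refine Finset.sum_congr rfl fun t ht => ?_
        rw [Function.update_of_ne (Finset.ne_of_mem_erase ht)]
    by_cases hzero : ∀ t ∈ T, Q (v t) = 0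
    · exact ⟨v, hzero, rfl⟩
    push Not at hzero
    obtain ⟨i, hi, hvi⟩ := Finset.exists_pos_of_sum_zero_of_exists_nonzero _ hv hzero
    obtain ⟨j, hj, hvj⟩ : ∃ j ∈ T, Q (v j) < 0 := by
      by_contra! hnonneg
      exact hvi.ne' ((Finset.sum_eq_zero_iff_of_nonneg hnonneg).1 hv i hi)
    have hij : j ≠ i := by
      rintro rfl
      exact hvi.not_gt hvj
    obtain ⟨c, s, hcs, hQ⟩ := Q.exists_rotation_eq_zero hvi hvj
    let v' := Function.update (Function.update v i (c • v i + s • v j)) j (-s • v i + c • v j)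
    have hv'i : v' i = c • v i + s • v j := by simp [v', hij.symm]
    have hv'j : v' j = -s • v i + c • v j := by simp [v']
    have hv' : ∀ t ∈ (T.erase i).erase j, v' t = v t := fun t ht => by
      simp only [Finset.mem_erase] at ht
      simp [v', ht.1, ht.2.1]
    have hji : j ∈ T.erase i := Finset.mem_erase.2 ⟨hij, hj⟩
    have hQsum : ∑ t ∈ T, Q (v' t) = ∑ t ∈ T, Q (v t) := by
      simp only [← Finset.add_sum_erase T _ hi, ← Finset.add_sum_erase _ _ hji, ← add_assoc]
      rw [hv'i, hv'j, Q.map_rotation_add_map_rotation hcs,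
        Finset.sum_congr rfl fun t ht => by rw [hv' t ht]]
    have hsum : ∑ t ∈ T, vecMulVec (v' t) (v' t) = ∑ t ∈ T, vecMulVec (v t) (v t) := by
      simp only [← Finset.add_sum_erase T _ hi, ← Finset.add_sum_erase _ _ hji, ← add_assoc]
      rw [hv'i, hv'j, Matrix.vecMulVec_rotation_add_vecMulVec_rotation hcs,
        Finset.sum_congr rfl fun t ht => by rw [hv' t ht]]
    rw [← hsum]
    exact of_isotropic v' (hQsum.trans hv) i hi (by rw [hv'i, hQ])

/-- The determinant of a vector of `ℝ² ⊗ ℝ²`, seen as a `2 × 2` matrix. -/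
def detForm : QuadraticForm ℝ (Fin 2 × Fin 2 → ℝ) :=
  QuadraticMap.linMulLin (LinearMap.proj (0, 0)) (LinearMap.proj (1, 1)) -
    QuadraticMap.linMulLin (LinearMap.proj (1, 0)) (LinearMap.proj (0, 1))

theorem detForm_apply (v : Fin 2 × Fin 2 → ℝ) :
    detForm v = v (0, 0) * v (1, 1) - v (1, 0) * v (0, 1) := rfl

/-- A vector of `ℝ² ⊗ ℝ²` with vanishing determinant is a product vector. -/
theorem exists_eq_mul_of_detForm_eq_zero {v : Fin 2 × Fin 2 → ℝ} (hv : detForm v = 0) :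
    ∃ x y : Fin 2 → ℝ, ∀ p, v p = x p.1 * y p.2 := by
  rw [detForm_apply] at hv
  by_cases h00 : v (0, 0) = 0
  · by_cases h10 : v (1, 0) = 0
    · refine ⟨![v (0, 1), v (1, 1)], ![0, 1], ?_⟩
      simp [Prod.forall, Fin.forall_fin_two, h00, h10]
    · refine ⟨![0, 1], ![v (1, 0), v (1, 1)], ?_⟩
      have h01 : v (0, 1) = 0 := by simpa [h00, h10] using hv
      simp [Prod.forall, Fin.forall_fin_two, h00, h01]
  · refine ⟨![1, v (1, 0) / v (0, 0)], ![v (0, 0), v (0, 1)], ?_⟩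
    have h11 : v (1, 1) = v (1, 0) / v (0, 0) * v (0, 1) := by
      field_simp
      linear_combination hv
    simp [Prod.forall, Fin.forall_fin_two, h00, h11]

/-- A G-invariant positive semidefinite matrix on `ℝ² ⊗ ℝ²` is a sum of `rank ρ`
real pure product states. -/
theorem gInvariant_psd_two_sum_product (ρ : Matrix (Fin 2 × Fin 2) (Fin 2 × Fin 2) ℝ)
    (hpsd : ρ.PosSemidef) (hg : GInvariant ρ) :
    ∃ x y : Fin ρ.rank → Fin 2 → ℝ,
      ρ = ∑ t, vecMulVec (x t) (x t) ⊗ₖ vecMulVec (y t) (y t) := by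
  obtain ⟨v, hv⟩ := hpsd.exists_eq_sum_vecMulVec_rank
  have hdet : ∑ t, detForm (v t) = 0 := by
    have hentry : ∀ p q, ρ p q = ∑ t, v t p * v t q := fun p q => by
      conv_lhs => rw [hv]
      simp [Matrix.sum_apply, vecMulVec_apply]
    simp only [detForm_apply, Finset.sum_sub_distrib, ← hentry]
    exact sub_eq_zero.2 (hg 0 1 0 1)
  obtain ⟨w, hw, hsum⟩ := detForm.exists_isotropic_sum_vecMulVec_eq Finset.univ v hdet
  choose x y hxy using fun t => exists_eq_mul_of_detForm_eq_zero (hw t (Finset.mem_univ t))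
  refine ⟨x, y, hv.trans (hsum.symm.trans (Finset.sum_congr rfl fun t _ => ?_))⟩
  ext p q
  simp only [kroneckerMap_apply, vecMulVec_apply, hxy]
  ring
end

section
/- Let ρ be a real positive semidefinite matrix on ℝ^N ⊗ ℝ^N that is G-invariant, is supported on ℝ^N ⊗ ℝ^N, and satisfies rank(ρ) = N. Then ρ is a sum of N real pure product states: there exist vectors x_1, …, x_N, y_1, …, y_N ∈ ℝ^N such that ρ = Σ_{t=1}^{N} (x_t x_tᵀ) ⊗ (y_t y_tᵀ). -/
open Matrix
open Kronecker
open scoped BigOperators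

open scoped InnerProductSpace

/-- If `⟪A x, B y⟫` is symmetric in the two maps, some member of the pencil `A + t B` has
kernel as small as possible, namely `ker A ⊓ ker B`. -/
theorem exists_ker_add_smul_le {M E : Type*} [AddCommGroup M] [Module ℝ M]
    [NormedAddCommGroup E] [InnerProductSpace ℝ E] [FiniteDimensional ℝ E]
    (A B : M →ₗ[ℝ] E) (h : ∀ x y, ⟪A x, B y⟫_ℝ = ⟪B x, A y⟫_ℝ) :
    ∃ t : ℝ, ∀ x, A x + t • B x = 0 → A x = 0 ∧ B x = 0 := by
  by_contra! hc
  choose x hx hx' using hc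
  have hA (t : ℝ) : A (x t) = -(t • B (x t)) := eq_neg_of_add_eq_zero_left (hx t)
  have hne (t : ℝ) : B (x t) ≠ 0 := fun h0 => hx' t (by simp [hA, h0]) h0
  have hli : LinearIndependent ℝ fun t => B (x t) := by
    refine linearIndependent_of_ne_zero_of_inner_eq_zero hne fun s t hst => ?_
    have := h (x s) (x t)
    simp only [hA, inner_neg_left, inner_neg_right, real_inner_smul_left,
      real_inner_smul_right] at this
    have h0 : (s - t) * ⟪B (x s), B (x t)⟫_ℝ = 0 := by linarith
    exact (mul_eq_zero.mp h0).resolve_left (sub_ne_zero.mpr hst)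
  exact not_finite_iff_infinite.mpr inferInstance hli.finite

/-- For maps `A k` with `⟪A k x, A l y⟫ = ⟪A l x, A k y⟫`, some linear combination of them
has kernel equal to the common kernel. -/
theorem exists_ker_sum_smul_le {κ M E : Type*} [AddCommGroup M] [Module ℝ M]
    [NormedAddCommGroup E] [InnerProductSpace ℝ E] [FiniteDimensional ℝ E]
    (A : κ → M →ₗ[ℝ] E) (h : ∀ k l x y, ⟪A k x, A l y⟫_ℝ = ⟪A l x, A k y⟫_ℝ)
    (s : Finset κ) :
    ∃ f : κ → ℝ, ∀ x, ∑ k ∈ s, f k • A k x = 0 → ∀ k ∈ s, A k x = 0 := by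
  classical
  induction s using Finset.induction_on with
  | empty => simp
  | insert m s hm ih =>
    obtain ⟨f, hf⟩ := ih
    obtain ⟨t, ht⟩ := exists_ker_add_smul_le (∑ k ∈ s, f k • A k) (A m) fun x y => by
      simp only [LinearMap.sum_apply, LinearMap.smul_apply, sum_inner, inner_sum,
        real_inner_smul_left, real_inner_smul_right, h m]
    refine ⟨Function.update f m t, fun x hx => ?_⟩
    have hs : ∑ k ∈ s, Function.update f m t k • A k x = ∑ k ∈ s, f k • A k x :=
      Finset.sum_congr rfl fun k hk => by
        rw [Function.update_of_ne (ne_of_mem_of_not_mem hk hm)]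
    rw [Finset.sum_insert hm, hs, Function.update_self, add_comm] at hx
    obtain ⟨h1, h2⟩ := ht x (by simpa using hx)
    intro k hk
    obtain rfl | hk := Finset.mem_insert.mp hk
    · exact h2
    · exact hf x (by simpa using h1) k hk

/-- A commuting family of symmetric operators has an orthonormal basis of joint eigenvectors. -/
theorem exists_orthonormalBasis_joint_eigenvectors {κ E : Type*} [NormedAddCommGroup E]
    [InnerProductSpace ℝ E] [FiniteDimensional ℝ E] {n : ℕ} (hn : Module.finrank ℝ E = n)
    (C : κ → E →ₗ[ℝ] E) (hC : ∀ k, (C k).IsSymmetric) (hcomm : ∀ k l, Commute (C k) (C l)) :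
    ∃ (u : OrthonormalBasis (Fin n) ℝ E) (c : κ → Fin n → ℝ), ∀ k t, C k (u t) = c k t • u t := by
  classical
  let V : (κ → ℝ) → Submodule ℝ E := fun α => ⨅ j, Module.End.eigenspace (C j) (α j)
  have hV : OrthogonalFamily ℝ (fun α => V α) fun α => (V α).subtypeₗᵢ :=
    LinearMap.IsSymmetric.orthogonalFamily_iInf_eigenspaces hC
  have hint : DirectSum.IsInternal V :=
    LinearMap.IsSymmetric.directSum_isInternal_of_pairwise_commute hC fun k l _ => hcomm k l
  let b := hint.collectedBasis fun α => (stdOrthonormalBasis ℝ (V α)).toBasis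
  have hb : Orthonormal ℝ b := by
    simpa [b] using hV.orthonormal_sigma_orthonormal
      (show ∀ α, Orthonormal ℝ (stdOrthonormalBasis ℝ (V α)).toBasis by simp)
  have := Module.Finite.finite_basis b
  have := Fintype.ofFinite (Σ α, Fin (Module.finrank ℝ (V α)))
  let e := Fintype.equivFinOfCardEq ((Module.finrank_eq_card_basis b).symm.trans hn)
  refine ⟨(b.toOrthonormalBasis hb).reindex e, fun k t => (e.symm t).1 k, fun k t => ?_⟩
  have hmem : b (e.symm t) ∈ V (e.symm t).1 := hint.collectedBasis_mem _ _
  simpa using Module.End.mem_eigenspace_iff.mp ((Submodule.mem_iInf _).mp hmem k)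

/-- Maps `A k` with `⟪A k x, A l y⟫ = ⟪A l x, A k y⟫` and trivial common kernel are
simultaneously diagonalizable relative to one map `a`. -/
theorem exists_orthonormalBasis_inner_eq_mul {κ M E : Type*} [Fintype κ] [AddCommGroup M]
    [Module ℝ M] [FiniteDimensional ℝ M] [NormedAddCommGroup E] [InnerProductSpace ℝ E]
    [FiniteDimensional ℝ E] {n : ℕ} (hM : Module.finrank ℝ M = n) (hE : Module.finrank ℝ E = n)
    (A : κ → M →ₗ[ℝ] E) (h : ∀ k l x y, ⟪A k x, A l y⟫_ℝ = ⟪A l x, A k y⟫_ℝ)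
    (hker : ∀ x, (∀ k, A k x = 0) → x = 0) :
    ∃ (a : M →ₗ[ℝ] E) (u : OrthonormalBasis (Fin n) ℝ E) (c : κ → Fin n → ℝ),
      ∀ k t x, ⟪u t, A k x⟫_ℝ = c k t * ⟪u t, a x⟫_ℝ := by
  obtain ⟨f, hf⟩ := exists_ker_sum_smul_le A h Finset.univ
  let a : M →ₗ[ℝ] E := ∑ k, f k • A k
  have ha : Function.Injective a := (injective_iff_map_eq_zero a).mpr fun x hx =>
    hker x fun k => hf x (by simpa [a] using hx) k (Finset.mem_univ k)
  have hA (k) (x y : M) : ⟪A k x, a y⟫_ℝ = ⟪a x, A k y⟫_ℝ := by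
    simp only [a, LinearMap.sum_apply, LinearMap.smul_apply, sum_inner, inner_sum,
      real_inner_smul_left, real_inner_smul_right, h k]
  let e := LinearEquiv.ofInjectiveOfFinrankEq a ha (hM.trans hE.symm)
  have he (x : M) : e x = a x := rfl
  let C (k : κ) : E →ₗ[ℝ] E := A k ∘ₗ e.symm.toLinearMap
  have hCe (k) (x : M) : C k (a x) = A k x := by simp [C, ← he]
  have hsurj : ∀ y, ∃ x, a x = y := e.surjective
  have hC (k) : (C k).IsSymmetric := fun x y => by
    obtain ⟨x, rfl⟩ := hsurj x
    obtain ⟨y, rfl⟩ := hsurj y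
    simp only [hCe, hA]
  have hcomm (k l) : Commute (C k) (C l) := LinearMap.ext fun x => ext_inner_right ℝ fun y => by
    obtain ⟨x, rfl⟩ := hsurj x
    obtain ⟨y, rfl⟩ := hsurj y
    rw [Module.End.mul_apply, Module.End.mul_apply, hC k (C l _), hC l (C k _)]
    simp only [hCe, h k l]
  obtain ⟨u, c, hu⟩ := exists_orthonormalBasis_joint_eigenvectors hE C hC hcomm
  refine ⟨a, u, c, fun k t x => ?_⟩
  rw [← hCe, ← hC k, hu, real_inner_smul_left]

/-- A real positive semidefinite matrix is the Gram matrix of vectors in a space whose dimension is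
its rank. -/
theorem Matrix.PosSemidef.exists_inner_eq {m : Type*} [Fintype m] [DecidableEq m]
    {ρ : Matrix m m ℝ} (hρ : ρ.PosSemidef) :
    ∃ (V : Submodule ℝ (EuclideanSpace ℝ m)) (v : m → V),
      Module.finrank ℝ V = ρ.rank ∧ ∀ p q, ρ p q = ⟪v p, v q⟫_ℝ := by
  obtain ⟨B, rfl⟩ : ∃ B : Matrix m m ℝ, ρ = Bᴴ * B := by
    open scoped ComplexOrder MatrixOrder Matrix.Norms.L2Operator in
    exact CStarAlgebra.nonneg_iff_eq_star_mul_self.mp hρ.nonneg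
  let L := (WithLp.linearEquiv 2 ℝ (m → ℝ)).symm
  refine ⟨(LinearMap.range B.mulVecLin).map L.toLinearMap,
    fun p => ⟨L (B.col p), Submodule.mem_map_of_mem ⟨Pi.single p 1, by simp⟩⟩, ?_, fun p q => ?_⟩
  · rw [LinearEquiv.finrank_map_eq, rank_conjTranspose_mul_self, Matrix.rank]
  · simp [L, Matrix.mul_apply, PiLp.inner_apply, mul_comm]

/-- A G-invariant positive semidefinite matrix supported on `ℝ^N ⊗ ℝ^N` with rank `N`
is a sum of `N` real pure product states. -/
theorem gInvariant_rankN_sum_product {N : ℕ}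
    (ρ : Matrix (Fin N × Fin N) (Fin N × Fin N) ℝ)
    (hpsd : ρ.PosSemidef) (hg : GInvariant ρ)
    (hsupp : (reducedMat ρ).rank = N) (hrank : ρ.rank = N) :
    ∃ x y : Fin N → Fin N → ℝ,
      ρ = ∑ t, vecMulVec (x t) (x t) ⊗ₖ vecMulVec (y t) (y t) := by
  obtain ⟨V, v, hV, hv⟩ := hpsd.exists_inner_eq
  let A (k : Fin N) : (Fin N → ℝ) →ₗ[ℝ] V := Fintype.linearCombination ℝ fun i => v (i, k)
  have hA (k i) : A k (Pi.single i 1) = v (i, k) := by simp [A]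
  have hsymm (k l x y) : ⟪A k x, A l y⟫_ℝ = ⟪A l x, A k y⟫_ℝ := by
    simp only [A, Fintype.linearCombination_apply, sum_inner, inner_sum,
      real_inner_smul_left, real_inner_smul_right]
    refine Finset.sum_congr rfl fun i _ => Finset.sum_congr rfl fun j _ => ?_
    rw [← hv, ← hv, hg, hv, hv, real_inner_comm]
  have hinj : Function.Injective (reducedMat ρ).mulVecLin := by
    rw [LinearMap.injective_iff_surjective, ← LinearMap.range_eq_top]
    exact Submodule.eq_top_of_finrank_eq (by simpa [Matrix.rank] using hsupp)
  have hker (z) (hz : ∀ k, A k z = 0) : z = 0 := by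
    refine (injective_iff_map_eq_zero _).mp hinj z (funext fun i => ?_)
    calc (reducedMat ρ *ᵥ z) i = ∑ k, ⟪v (i, k), A k z⟫_ℝ := by
          simp only [mulVec, dotProduct, reducedMat, of_apply, Finset.sum_mul, hv, A,
            Fintype.linearCombination_apply, inner_sum, real_inner_smul_right]
          rw [Finset.sum_comm]
          simp only [mul_comm]
      _ = 0 := by simp [hz]
  obtain ⟨a, u, c, hu⟩ :=
    exists_orthonormalBasis_inner_eq_mul (by simp) (hV.trans hrank) A hsymm hker
  refine ⟨fun t i => ⟪u t, a (Pi.single i 1)⟫_ℝ, fun t k => c k t, ?_⟩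
  ext ⟨i, k⟩ ⟨j, l⟩
  rw [hv, ← u.sum_inner_mul_inner, Matrix.sum_apply]
  refine Finset.sum_congr rfl fun t _ => ?_
  rw [real_inner_comm, ← hA, ← hA, hu, hu]
  simp only [kroneckerMap_apply, vecMulVec_apply]
  ring
end

section
/- Let ρ be a completely symmetric state on ℝ^N ⊗ ℝ^N that is supported on ℝ^N ⊗ ℝ^N and satisfies rank(ρ) = N. Then ρ is S-separable. -/
open Matrix
open Kronecker
open scoped BigOperators

open Module

section SymmetricPencil

variable {V W ι : Type*} [AddCommGroup V] [Module ℝ V]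
  [NormedAddCommGroup W] [InnerProductSpace ℝ W] [FiniteDimensional ℝ W]

/-- If `fᵀ g` is symmetric, then some member `f + t g` of the pencil has kernel
`ker f ∩ ker g`: kernel vectors for distinct bad `t` have nonzero orthogonal images under `g`. -/
lemma exists_ker_add_smul_le_s5 (f g : V →ₗ[ℝ] W)
    (h : ∀ x y, inner ℝ (f x) (g y) = inner ℝ (g x) (f y)) :
    ∃ t : ℝ, LinearMap.ker (f + t • g) ≤ LinearMap.ker f ⊓ LinearMap.ker g := by
  by_contra! hbad
  have hx (t : ℝ) : ∃ x, f x = -(t • g x) ∧ g x ≠ 0 := by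
    obtain ⟨x, hx, hx'⟩ := SetLike.not_le_iff_exists.mp (hbad t)
    have hfx : f x = -(t • g x) := eq_neg_of_add_eq_zero_left (by simpa using hx)
    refine ⟨x, hfx, fun hg => hx' ?_⟩
    simp [hfx, hg]
  choose x hf hg using hx
  have hli : LinearIndependent ℝ fun t => g (x t) := by
    refine linearIndependent_of_ne_zero_of_inner_eq_zero hg fun s t hst => ?_
    have := h (x s) (x t)
    rw [hf, hf, inner_neg_left, inner_neg_right, real_inner_smul_left,
      real_inner_smul_right] at this
    have hmul : (s - t) * inner ℝ (g (x s)) (g (x t)) = 0 := by linarith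
    exact (mul_eq_zero.mp hmul).resolve_left (sub_ne_zero.mpr hst)
  have := hli.finite
  exact not_finite ℝ

/-- A finite family of maps with all `(A k)ᵀ (A l)` symmetric has a linear combination whose
kernel is the common kernel. -/
lemma exists_ker_sum_smul_le_s5 (A : ι → V →ₗ[ℝ] W)
    (h : ∀ k l x y, inner ℝ (A k x) (A l y) = inner ℝ (A l x) (A k y)) (s : Finset ι) :
    ∃ e : ι → ℝ, ∀ k ∈ s, LinearMap.ker (∑ i ∈ s, e i • A i) ≤ LinearMap.ker (A k) := by
  classical
  induction s using Finset.induction_on with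
  | empty => simp
  | insert a s ha ih =>
    obtain ⟨e, he⟩ := ih
    obtain ⟨t, ht⟩ := exists_ker_add_smul_le_s5 (∑ i ∈ s, e i • A i) (A a) fun x y => by
      simp only [LinearMap.sum_apply, LinearMap.smul_apply, sum_inner, inner_sum,
        real_inner_smul_left, real_inner_smul_right, h _ a]
    refine ⟨Function.update e a t, ?_⟩
    have hsum : ∑ i ∈ insert a s, Function.update e a t i • A i
        = (∑ i ∈ s, e i • A i) + t • A a := by
      rw [Finset.sum_insert ha, Function.update_self, add_comm]
      congr 1
      refine Finset.sum_congr rfl fun i hi => ?_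
      rw [Function.update_of_ne (ne_of_mem_of_not_mem hi ha)]
    rw [hsum]
    intro k hk
    rcases Finset.mem_insert.mp hk with rfl | hk
    · exact ht.trans inf_le_right
    · exact ht.trans (inf_le_left.trans (he k hk))

/-- Commuting symmetric operators on a finite-dimensional real inner product space have a
common orthonormal eigenbasis. -/
lemma exists_orthonormalBasis_joint_eigenvectors_s5 [Finite ι] (C : ι → W →ₗ[ℝ] W)
    (hC : ∀ k, (C k).IsSymmetric) (hcomm : ∀ k l, Commute (C k) (C l)) :
    ∃ (L : ℕ) (u : OrthonormalBasis (Fin L) ℝ W) (lam : Fin L → ι → ℝ),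
      ∀ a k, C k (u a) = lam a k • u a := by
  classical
  have hint := LinearMap.IsSymmetric.directSum_isInternal_of_pairwise_commute hC
    fun k l _ => hcomm k l
  have horth := LinearMap.IsSymmetric.orthogonalFamily_iInf_eigenspaces hC
  let v (χ : ι → ℝ) := stdOrthonormalBasis ℝ
    (⨅ j, End.eigenspace (C j) (χ j) : Submodule ℝ W)
  let b := hint.collectedBasis fun χ => (v χ).toBasis
  have hb : Orthonormal ℝ b :=
    DirectSum.IsInternal.collectedBasis_orthonormal horth hint fun χ => by simp
  let _ := FiniteDimensional.fintypeBasisIndex b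
  let ψ := Fintype.equivFin (Σ χ : ι → ℝ, Fin (finrank ℝ
    (⨅ j, End.eigenspace (C j) (χ j) : Submodule ℝ W)))
  refine ⟨_, (b.toOrthonormalBasis hb).reindex ψ, fun a => (ψ.symm a).1, fun a k => ?_⟩
  have hmem := hint.collectedBasis_mem (fun χ => (v χ).toBasis) (ψ.symm a)
  rw [OrthonormalBasis.reindex_apply, Basis.coe_toOrthonormalBasis]
  exact End.mem_eigenspace_iff.mp ((Submodule.mem_iInf _).mp hmem k)

end SymmetricPencil

/-- A completely symmetric Gram matrix of vectors in an `N`-dimensional space is S-separable as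
soon as no nonzero combination `∑ i, x i • v i k` vanishes for all `k`. -/
lemma sSeparable_of_gram {N : ℕ} {F : Type*} [NormedAddCommGroup F] [InnerProductSpace ℝ F]
    [FiniteDimensional ℝ F] (hF : finrank ℝ F = N)
    {ρ : Matrix (Fin N × Fin N) (Fin N × Fin N) ℝ} (v : Fin N → Fin N → F)
    (hρ : ∀ i k j l, ρ (i, k) (j, l) = inner ℝ (v i k) (v j l))
    (hsymm : ∀ i k, v i k = v k i)
    (hswap : ∀ i j k l, inner ℝ (v i k) (v j l) = (inner ℝ (v i l) (v j k) : ℝ))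
    (hker : ∀ x : Fin N → ℝ, (∀ k, ∑ i, x i • v i k = 0) → x = 0) :
    SSeparable ρ := by
  let A (k : Fin N) : (Fin N → ℝ) →ₗ[ℝ] F := Fintype.linearCombination ℝ fun i => v i k
  have hA (k x) : A k x = ∑ i, x i • v i k := Fintype.linearCombination_apply _ _ _
  have hA1 (k i) : A k (Pi.single i 1) = v i k := by simp [A]
  have hAswap (k l x y) : inner ℝ (A k x) (A l y) = (inner ℝ (A l x) (A k y) : ℝ) := by
    simp only [hA, sum_inner, inner_sum, real_inner_smul_left, real_inner_smul_right,
      hswap _ _ k l]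
  obtain ⟨e, he⟩ := exists_ker_sum_smul_le_s5 A hAswap Finset.univ
  let B := ∑ k, e k • A k
  have hBinj : LinearMap.ker B = ⊥ := by
    rw [LinearMap.ker_eq_bot']
    intro x hx
    refine hker x fun k => ?_
    rw [← hA]
    exact he k (Finset.mem_univ k) hx
  let β : (Fin N → ℝ) ≃ₗ[ℝ] F := LinearEquiv.ofInjectiveOfFinrankEq B
    (LinearMap.ker_eq_bot.mp hBinj) (by simp [hF])
  have hβ (x) : β x = ∑ k, e k • A k x := by
    rw [← LinearEquiv.coe_coe, LinearEquiv.coe_ofInjectiveOfFinrankEq]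
    simp [B]
  have hβswap (k x y) : inner ℝ (β x) (A k y) = (inner ℝ (A k x) (β y) : ℝ) := by
    simp only [hβ, sum_inner, inner_sum, real_inner_smul_left, real_inner_smul_right,
      hAswap _ k]
  let C (k : Fin N) : F →ₗ[ℝ] F := A k ∘ₗ β.symm.toLinearMap
  have hCβ (k x) : C k (β x) = A k x := by simp [C]
  have hCsymm (k) : (C k).IsSymmetric := by
    intro p q
    obtain ⟨x, rfl⟩ := β.surjective p
    obtain ⟨y, rfl⟩ := β.surjective q
    rw [hCβ, hCβ, hβswap]
  have hCcomm (k l) : Commute (C k) (C l) := by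
    refine LinearMap.ext fun q => ext_inner_left ℝ fun p => ?_
    obtain ⟨x, rfl⟩ := β.surjective p
    obtain ⟨y, rfl⟩ := β.surjective q
    simp only [Module.End.mul_apply]
    rw [← hCsymm k (β x), ← hCsymm l (β x) (C k _)]
    simp only [hCβ, hAswap k l]
  obtain ⟨L, u, lam, hlam⟩ := exists_orthonormalBasis_joint_eigenvectors_s5 C hCsymm hCcomm
  let w (a : Fin L) (i : Fin N) : ℝ := inner ℝ (β (Pi.single i 1)) (u a)
  have hvu (a i k) : inner ℝ (v i k) (u a) = lam a k * w a i := by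
    rw [← hA1, ← hCβ, hCsymm, hlam, real_inner_smul_right]
  let s (a : Fin L) : ℝ := ∑ k, e k * w a k
  have hw (a i) : w a i = lam a i * s a := by
    have hw' : w a i = ∑ k, e k * inner ℝ (v i k) (u a) := by
      simp only [w, hβ, hA1, sum_inner, real_inner_smul_left]
    rw [hw', Finset.mul_sum]
    refine Finset.sum_congr rfl fun k _ => ?_
    rw [hsymm, hvu]
    ring
  refine ⟨L, fun a => √|s a| • lam a, ?_⟩
  ext ⟨i, k⟩ ⟨j, l⟩
  rw [hρ, ← u.sum_inner_mul_inner, Matrix.sum_apply]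
  refine Finset.sum_congr rfl fun a _ => ?_
  rw [real_inner_comm (v j l), hvu, hvu, hw, hw]
  simp only [kroneckerMap_apply, vecMulVec_apply, Pi.smul_apply, smul_eq_mul]
  have h1 : √|s a| * √|s a| = |s a| := Real.mul_self_sqrt (abs_nonneg _)
  have h2 := abs_mul_abs_self (s a)
  linear_combination (-(lam a i * lam a j * lam a k * lam a l)) *
    ((√|s a| * √|s a| + |s a|) * h1 + h2)

open scoped MatrixOrder in
/-- A real positive semidefinite matrix is the Gram matrix of vectors in a space whose dimension
is its rank. -/
lemma Matrix.PosSemidef.exists_gram {m : Type*} [Fintype m] [DecidableEq m]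
    {M : Matrix m m ℝ} (hM : M.PosSemidef) :
    ∃ (F : Submodule ℝ (EuclideanSpace ℝ m)) (v : m → F), finrank ℝ F = M.rank ∧
      ∀ p q, M p q = inner ℝ (v p) (v q) := by
  obtain ⟨B, rfl⟩ := CStarAlgebra.nonneg_iff_eq_star_mul_self.mp hM.nonneg
  let ε := (WithLp.linearEquiv 2 ℝ (m → ℝ)).symm
  refine ⟨(LinearMap.range B.mulVecLin).map ε.toLinearMap,
    fun p => ⟨ε (B.mulVecLin (Pi.single p 1)), Submodule.mem_map_of_mem ⟨_, rfl⟩⟩, ?_, ?_⟩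
  · rw [star_eq_conjTranspose, rank_conjTranspose_mul_self]
    exact LinearEquiv.finrank_map_eq ε _
  · intro p q
    simp [ε, Matrix.mul_apply, PiLp.inner_apply, star_eq_conjTranspose, mul_comm]

/-- A completely symmetric state supported on `ℝ^N ⊗ ℝ^N` with rank `N` is S-separable. -/
theorem completelySymmetric_rankN_sSeparable {N : ℕ}
    (ρ : Matrix (Fin N × Fin N) (Fin N × Fin N) ℝ)
    (hcs : CompletelySymmetric ρ) (hpsd : ρ.PosSemidef) (htr : ρ.trace = 1)
    (hsupp : (reducedMat ρ).rank = N) (hrank : ρ.rank = N) :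
    SSeparable ρ := by
  obtain ⟨F, v, hF, hv⟩ := hpsd.exists_gram
  have hswap (i j k l) : ρ (i, k) (j, l) = ρ (i, l) (j, k) := by
    simpa [Equiv.swap_apply_def] using (hcs (Equiv.swap 2 3) ![i, j, k, l]).symm
  have hflip (i j k l) : ρ (i, k) (j, l) = ρ (k, i) (j, l) := by
    simpa [Equiv.swap_apply_def] using (hcs (Equiv.swap 0 2) ![i, j, k, l]).symm
  refine sSeparable_of_gram (hF.trans hrank) (fun i k => v (i, k))
    (fun i k j l => hv _ _) (fun i k => ?_) (fun i j k l => ?_) (fun x hx => ?_)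
  · rw [← sub_eq_zero, ← inner_self_eq_zero (𝕜 := ℝ)]
    simp only [inner_sub_left, inner_sub_right, ← hv]
    rw [hflip k k i i, hflip k i i k]
    ring
  · rw [← hv, ← hv, hswap]
  · have hmul : reducedMat ρ *ᵥ x = 0 := by
      ext i
      simp only [mulVec, dotProduct, reducedMat, of_apply, Finset.sum_mul, Pi.zero_apply]
      rw [Finset.sum_comm]
      refine Finset.sum_eq_zero fun k _ => ?_
      have := congrArg (fun z => (inner ℝ (v (i, k)) z : ℝ)) (hx k)
      simpa only [inner_sum, real_inner_smul_right, ← hv, inner_zero_right, mul_comm] using this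
    have hinj := (LinearMap.ker_eq_bot (f := (reducedMat ρ).mulVecLin)).mpr ?_
    · exact LinearMap.ker_eq_bot'.mp hinj x hmul
    · rw [LinearMap.injective_iff_surjective, ← LinearMap.range_eq_top]
      apply Submodule.eq_top_of_finrank_eq
      simpa [Matrix.rank] using hsupp
end

section
/- Every completely symmetric state of rank 2 on ℝ^N ⊗ ℝ^N is S-separable. -/
open Matrix
open Kronecker
open scoped BigOperators

namespace Matrix

variable {n : Type*} [Fintype n] [DecidableEq n]

/-- A rank factorization of a real positive semidefinite matrix. -/
theorem PosSemidef.exists_rank_factorization {M : Matrix n n ℝ} (hM : M.PosSemidef)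
    {r : ℕ} (hr : M.rank = r) :
    ∃ (C : Matrix (Fin r) n ℝ) (R : Matrix n (Fin r) ℝ), M = Cᵀ * C ∧ C * R = 1 := by
  have hH := hM.isHermitian
  have e : Fin r ≃ {i // hH.eigenvalues i ≠ 0} :=
    (finCongr (hr ▸ hH.rank_eq_card_non_zero_eigs)).trans (Fintype.equivFin _).symm
  set U : Matrix n n ℝ := hH.eigenvectorUnitary.1 with hU
  have hUU : Uᵀ * U = 1 := by
    have := (Matrix.mem_unitaryGroup_iff').1 hH.eigenvectorUnitary.2
    simpa [star_eq_conjTranspose] using this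
  have hpos (s : {i // hH.eigenvalues i ≠ 0}) : 0 < hH.eigenvalues s :=
    (hM.eigenvalues_nonneg _).lt_of_ne' s.2
  refine ⟨of fun s x => √(hH.eigenvalues (e s)) * U x (e s),
    of fun x s => U x (e s) / √(hH.eigenvalues (e s)), ?_, ?_⟩
  · ext x y
    have hsum : M x y = ∑ i, hH.eigenvalues i * (U x i * U y i) := by
      conv_lhs => rw [hH.spectral_theorem]
      simp only [Unitary.conjStarAlgAut_apply, mul_apply, diagonal_apply, star_apply, ← hU]
      simp [mul_comm, mul_assoc]
    simp only [mul_apply, transpose_apply, of_apply]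
    rw [hsum, e.sum_comp (fun i => √(hH.eigenvalues i) * U x i * (√(hH.eigenvalues i) * U y i)),
      ← Fintype.sum_subtype_add_sum_subtype (fun i => hH.eigenvalues i ≠ 0)]
    rw [Finset.sum_eq_zero (s := (Finset.univ : Finset {i // ¬ hH.eigenvalues i ≠ 0})) fun i _ => by
      simp [not_not.1 i.2], add_zero]
    refine Finset.sum_congr rfl fun i _ => ?_
    nth_rewrite 1 [← Real.mul_self_sqrt (hpos i).le]
    ring
  · ext s t
    have h := congrFun (congrFun hUU (e s)) (e t)
    simp only [mul_apply, transpose_apply, of_apply] at h ⊢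
    have hfac : ∀ x, √(hH.eigenvalues (e s)) * U x (e s) * (U x (e t) / √(hH.eigenvalues (e t))) =
        √(hH.eigenvalues (e s)) / √(hH.eigenvalues (e t)) * (U x (e s) * U x (e t)) :=
      fun x => by ring
    simp only [hfac, ← Finset.mul_sum, h, one_apply]
    by_cases hst : s = t
    · subst hst
      simp [(Real.sqrt_pos.2 (hpos (e s))).ne']
    · have : (e s : n) ≠ e t := fun h => hst (e.injective (Subtype.ext h))
      simp [hst, this]

/-- Simultaneous diagonalization by congruence of a real positive semidefinite matrix `A` and a
symmetric matrix `B` whose kernel contains that of `A`. -/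
theorem PosSemidef.exists_simultaneous_diagonalization {A B : Matrix n n ℝ} (hA : A.PosSemidef)
    (hB : B.IsSymm) (hker : ∀ Z : Matrix n n ℝ, A * Z = 0 → B * Z = 0) :
    ∃ (r : ℕ) (W : Matrix (Fin r) n ℝ) (Q : Matrix n (Fin r) ℝ) (d : Fin r → ℝ),
      W * Q = 1 ∧ A = Wᵀ * W ∧ B = Wᵀ * diagonal d * W := by
  obtain ⟨r, hr⟩ : ∃ r, A.rank = r := ⟨_, rfl⟩
  obtain ⟨C, R, hAC, hCR⟩ := hA.exists_rank_factorization hr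
  have hBR : B = B * (R * C) := by
    have h := hker (1 - R * C) (by
      rw [hAC, mul_sub, mul_one, Matrix.mul_assoc, ← Matrix.mul_assoc C R C, hCR, Matrix.one_mul,
        sub_self])
    rwa [mul_sub, mul_one, sub_eq_zero] at h
  have hRB : B = (R * C)ᵀ * B := by
    have h := congrArg (·ᵀ) hBR
    simpa only [transpose_mul B, hB.eq] using h
  have hD : (Rᵀ * B * R).IsHermitian := by
    simp [IsHermitian, conjTranspose_eq_transpose_of_trivial, hB.eq, Matrix.mul_assoc]
  set V : Matrix (Fin r) (Fin r) ℝ := hD.eigenvectorUnitary.1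
  have hVV : Vᵀ * V = 1 := by
    have := (Matrix.mem_unitaryGroup_iff').1 hD.eigenvectorUnitary.2
    simpa [star_eq_conjTranspose] using this
  have hVV' : V * Vᵀ = 1 := mul_eq_one_comm.1 hVV
  have hspec : Rᵀ * B * R = V * diagonal hD.eigenvalues * Vᵀ := by
    conv_lhs => rw [hD.spectral_theorem]
    rw [Unitary.conjStarAlgAut_apply, star_eq_conjTranspose,
      conjTranspose_eq_transpose_of_trivial]
    rfl
  refine ⟨r, Vᵀ * C, R * V, hD.eigenvalues, ?_, ?_, ?_⟩
  · rw [Matrix.mul_assoc, ← Matrix.mul_assoc C, hCR, Matrix.one_mul, hVV]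
  · rw [transpose_mul, transpose_transpose, Matrix.mul_assoc, ← Matrix.mul_assoc V, hVV',
      Matrix.one_mul, ← hAC]
  · calc B = Cᵀ * (Rᵀ * B * R) * C := by
          conv_lhs => rw [hRB, hBR]
          simp only [transpose_mul, Matrix.mul_assoc]
      _ = _ := by
          conv_lhs => rw [hspec]
          simp only [transpose_mul, transpose_transpose, Matrix.mul_assoc]

end Matrix

namespace CompletelySymmetric

variable {N : ℕ} {ρ : Matrix (Fin N × Fin N) (Fin N × Fin N) ℝ}

theorem swap_left (hρ : CompletelySymmetric ρ) (i k : Fin N) (y : Fin N × Fin N) :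
    ρ (i, k) y = ρ (k, i) y := by
  simpa [Equiv.swap_apply_of_ne_of_ne] using (hρ (Equiv.swap 0 2) ![i, y.1, k, y.2]).symm

theorem swap_outer (hρ : CompletelySymmetric ρ) (i k j l : Fin N) :
    ρ (i, k) (l, j) = ρ (i, j) (l, k) := by
  simpa [Equiv.swap_apply_of_ne_of_ne] using hρ (Equiv.swap 2 3) ![i, l, j, k]

end CompletelySymmetric

/-- Contracting a completely symmetric matrix `vec A (vec A)ᵀ + vec B (vec B)ᵀ` with `X` along two
different pairs of indices gives the same result. -/
theorem CompletelySymmetric.mul_mul_add_mul_mul {N : ℕ}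
    {ρ : Matrix (Fin N × Fin N) (Fin N × Fin N) ℝ} {A B : Matrix (Fin N) (Fin N) ℝ}
    (hcs : CompletelySymmetric ρ)
    (hρ : ∀ i k j l, ρ (i, k) (j, l) = A i k * A j l + B i k * B j l)
    (X : Matrix (Fin N) (Fin N) ℝ) :
    A * X * A + B * X * B = (X * A).trace • A + (X * B).trace • B := by
  ext i j
  simp only [Matrix.add_apply, Matrix.smul_apply, smul_eq_mul, Matrix.trace, Matrix.diag,
    Matrix.mul_apply, Finset.sum_mul, ← Finset.sum_add_distrib]
  rw [Finset.sum_comm]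
  refine Finset.sum_congr rfl fun k _ => Finset.sum_congr rfl fun l _ => ?_
  have h := hcs.swap_outer i k j l
  rw [hρ, hρ] at h
  linear_combination X k l * h

/-- A completely symmetric state which is a sum of two squares is, after a rotation, the sum of the
squares of two symmetric matrices the second of which is traceless. -/
theorem CompletelySymmetric.exists_symm_decomposition {N : ℕ}
    {ρ : Matrix (Fin N × Fin N) (Fin N × Fin N) ℝ}
    (hcs : CompletelySymmetric ρ) (hpsd : ρ.PosSemidef) (htr : ρ.trace = 1)
    (hrank : ρ.rank = 2) :
    ∃ A B : Matrix (Fin N) (Fin N) ℝ, A.IsSymm ∧ B.IsSymm ∧ A.trace = 1 ∧ B.trace = 0 ∧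
      ∀ i k j l, ρ (i, k) (j, l) = A i k * A j l + B i k * B j l := by
  obtain ⟨C, R, hC, hCR⟩ := hpsd.exists_rank_factorization hrank
  have hsymm (s : Fin 2) (i k : Fin N) : C s (i, k) = C s (k, i) := by
    have hCt : Cᵀ = ρ * R := by rw [hC, Matrix.mul_assoc, hCR, Matrix.mul_one]
    have h (x : Fin N × Fin N) : C s x = ∑ y, ρ x y * R y s := by
      rw [← Matrix.mul_apply, ← hCt, Matrix.transpose_apply]
    simp only [h, hcs.swap_left i k]
  let a (s : Fin 2) : Matrix (Fin N) (Fin N) ℝ := of fun i k => C s (i, k)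
  have ha (s : Fin 2) : (a s).IsSymm := by
    ext i k
    exact hsymm s k i
  have hρ (i k j l : Fin N) : ρ (i, k) (j, l) = a 0 i k * a 0 j l + a 1 i k * a 1 j l := by
    rw [hC]
    simp [Matrix.mul_apply, a]
  have hT : (a 0).trace * (a 0).trace + (a 1).trace * (a 1).trace = 1 := by
    have h := congrArg Matrix.trace (hcs.mul_mul_add_mul_mul hρ 1)
    simp only [Matrix.mul_one, Matrix.one_mul, Matrix.trace_add, Matrix.trace_smul,
      smul_eq_mul] at h
    rw [← h, ← htr]
    simp only [Matrix.trace, Matrix.diag, Matrix.mul_apply, Fintype.sum_prod_type,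
      ← Finset.sum_add_distrib]
    refine Finset.sum_congr rfl fun i _ => Finset.sum_congr rfl fun k _ => ?_
    rw [hρ, (ha 0).apply i k, (ha 1).apply i k]
  refine ⟨(a 0).trace • a 0 + (a 1).trace • a 1, (a 0).trace • a 1 - (a 1).trace • a 0,
    ((ha 0).smul _).add ((ha 1).smul _), ((ha 1).smul _).sub ((ha 0).smul _), ?_, ?_, ?_⟩
  · simpa using hT
  · simp [mul_comm]
  · intro i k j l
    rw [hρ]
    simp only [Matrix.add_apply, Matrix.sub_apply, Matrix.smul_apply, smul_eq_mul]
    linear_combination -(a 0 i k * a 0 j l + a 1 i k * a 1 j l) * hT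

/-- Every completely symmetric state of rank 2 is S-separable. -/
theorem completelySymmetric_rank_two_sSeparable {N : ℕ}
    (ρ : Matrix (Fin N × Fin N) (Fin N × Fin N) ℝ)
    (hcs : CompletelySymmetric ρ) (hpsd : ρ.PosSemidef) (htr : ρ.trace = 1)
    (hrank : ρ.rank = 2) :
    SSeparable ρ := by
  obtain ⟨A, B, hA, hB, htA, htB, hρ⟩ := hcs.exists_symm_decomposition hpsd htr hrank
  have hkey := hcs.mul_mul_add_mul_mul hρ
  have hAB : Aᵀ * A + Bᵀ * B = A := by
    simpa [htA, htB, hA.eq, hB.eq] using hkey 1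
  have hApos : A.PosSemidef := by
    rw [← hAB]
    exact (posSemidef_conjTranspose_mul_self A).add (posSemidef_conjTranspose_mul_self B)
  have hker (Z : Matrix (Fin N) (Fin N) ℝ) (hZ : A * Z = 0) : B * Z = 0 := by
    have hBBZ : Bᵀ * B * Z = 0 := by
      have h := congrArg (· * Z) hAB
      simpa only [Matrix.add_mul, Matrix.mul_assoc, hZ, Matrix.mul_zero, zero_add] using h
    rw [← Matrix.conjTranspose_mul_self_eq_zero, Matrix.conjTranspose_mul,
      Matrix.conjTranspose_eq_transpose_of_trivial B, Matrix.mul_assoc, ← Matrix.mul_assoc Bᵀ,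
      hBBZ, Matrix.mul_zero]
  obtain ⟨r, W, Q, d, hWQ, hAW, hBW⟩ := hApos.exists_simultaneous_diagonalization hB hker
  have hQW : Qᵀ * Wᵀ = 1 := by rw [← Matrix.transpose_mul, hWQ, Matrix.transpose_one]
  have hd (p q : Fin r) (hpq : p ≠ q) : 1 + d p * d q = 0 := by
    have hQA : Qᵀ * A * Q = 1 := by
      rw [hAW, ← Matrix.mul_assoc, hQW, Matrix.one_mul, hWQ]
    have hQB : Qᵀ * B * Q = diagonal d := by
      rw [hBW, ← Matrix.mul_assoc, ← Matrix.mul_assoc, hQW, Matrix.one_mul, Matrix.mul_assoc, hWQ,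
        Matrix.mul_one]
    set Y : Matrix (Fin r) (Fin r) ℝ := Matrix.single p q 1
    have htrace (M : Matrix (Fin N) (Fin N) ℝ) :
        (Q * Y * Qᵀ * M).trace = (Y * (Qᵀ * M * Q)).trace := by
      rw [Matrix.mul_assoc Q, Matrix.mul_assoc Q, Matrix.trace_mul_comm]
      simp only [Matrix.mul_assoc]
    have hconj (M : Matrix (Fin N) (Fin N) ℝ) :
        Qᵀ * (M * (Q * Y * Qᵀ) * M) * Q = (Qᵀ * M * Q) * Y * (Qᵀ * M * Q) := by
      simp only [Matrix.mul_assoc]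
    have h := congrArg (fun M => (Qᵀ * M * Q) p q) (hkey (Q * Y * Qᵀ))
    simp only [Matrix.mul_add, Matrix.add_mul, hconj, Matrix.mul_smul, Matrix.smul_mul, htrace,
      hQA, hQB] at h
    simpa [Y, hpq, Matrix.one_apply, Matrix.diagonal_apply] using h
  have hAe (i k : Fin N) : A i k = ∑ p, W p i * W p k := by
    rw [hAW]
    simp [Matrix.mul_apply]
  have hBe (i k : Fin N) : B i k = ∑ p, d p * (W p i * W p k) := by
    rw [hBW]
    simp [Matrix.mul_apply, Matrix.diagonal_apply, mul_assoc, mul_left_comm]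
  refine ⟨r, fun p => √√(1 + d p * d p) • W p, ?_⟩
  ext ⟨i, k⟩ ⟨j, l⟩
  rw [hρ, hAe, hAe, hBe, hBe, Finset.sum_mul_sum, Finset.sum_mul_sum, Matrix.sum_apply,
    ← Finset.sum_add_distrib]
  refine Finset.sum_congr rfl fun p _ => ?_
  rw [← Finset.sum_add_distrib, Finset.sum_eq_single p]
  · have h1 : √√(1 + d p * d p) * √√(1 + d p * d p) = √(1 + d p * d p) :=
      Real.mul_self_sqrt (Real.sqrt_nonneg _)
    have h2 : √(1 + d p * d p) * √(1 + d p * d p) = 1 + d p * d p :=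
      Real.mul_self_sqrt (add_nonneg zero_le_one (mul_self_nonneg _))
    simp only [kroneckerMap_apply, vecMulVec_apply, Pi.smul_apply, smul_eq_mul]
    linear_combination -(W p i * W p j * W p k * W p l) * (h2 +
      (√√(1 + d p * d p) * √√(1 + d p * d p) + √(1 + d p * d p)) * h1)
  · intro q _ hqp
    linear_combination (W p i * W p k * W q j * W q l) * hd p q hqp.symm
  · simp
end

section
/- Let ρ be a completely symmetric state on ℝ² ⊗ ℝ² (a 4×4 matrix). Then there exists a nonzero vector x ∈ ℝ² such that the symmetric product vector x ⊗ x lies in the column space (range) of ρ. -/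
open Matrix
open Kronecker
open scoped BigOperators

/-- Complete symmetry gives invariance of the entries under index transpositions. -/
theorem CompletelySymmetric.apply_swap {N : ℕ} {ρ : Matrix (Fin N × Fin N) (Fin N × Fin N) ℝ}
    (h : CompletelySymmetric ρ) (i j k l : Fin N) :
    ρ (k, i) (j, l) = ρ (i, k) (j, l) ∧ ρ (i, k) (l, j) = ρ (i, k) (j, l) ∧
      ρ (j, k) (i, l) = ρ (i, k) (j, l) := by
  refine ⟨?_, ?_, ?_⟩
  · simpa [Equiv.swap_apply_def] using h (Equiv.swap 0 2) ![i, j, k, l]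
  · simpa [Equiv.swap_apply_def] using h (Equiv.swap 1 3) ![i, j, k, l]
  · simpa [Equiv.swap_apply_def] using h (Equiv.swap 0 1) ![i, j, k, l]

/-- A principal `2 × 2` minor of a real positive semidefinite matrix is nonnegative. -/
theorem Matrix.PosSemidef.mul_apply_le {n : Type*} {M : Matrix n n ℝ} (hM : M.PosSemidef)
    (p q : n) : M p q * M q p ≤ M p p * M q q := by
  have h := (hM.submatrix ![p, q]).det_nonneg
  rw [Matrix.det_fin_two] at h
  exact sub_nonneg.1 h

/-- If the Hankel form with leading block `[[a, b], [b, c]]` is positive definite on that block,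
then the span of the first two Hankel columns meets the moment curve. -/
theorem exists_hankel_moment {a b c d : ℝ} (hD : b * b < a * c) :
    ∃ t u v : ℝ, a * u + b * v = 1 ∧ b * u + c * v = t ∧ c * u + d * v = t * t := by
  have hD' : 0 < a * c - b * b := sub_pos.2 hD
  have ha : a ≠ 0 := by rintro rfl; nlinarith [mul_self_nonneg b]
  obtain ⟨t, ht⟩ : ∃ t : ℝ, (a * c - b * b) * (t * t) + (b * c - a * d) * t
      + (b * d - c * c) = 0 := by
    refine exists_quadratic_eq_zero hD'.ne' ⟨√(discrim _ _ _), (Real.mul_self_sqrt ?_).symm⟩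
    have key : a ^ 2 * discrim (a * c - b * b) (b * c - a * d) (b * d - c * c) =
        (a * (b * c - a * d) + 2 * b * (a * c - b * b)) ^ 2 + 4 * (a * c - b * b) ^ 3 := by
      unfold discrim; ring
    refine nonneg_of_mul_nonneg_right ?_ (pow_pos (abs_pos.2 ha) 2)
    rw [sq_abs, key]
    positivity
  refine ⟨t, (c - b * t) / (a * c - b * b), (a * t - b) / (a * c - b * b), ?_, ?_, ?_⟩ <;>
    rw [← mul_div_assoc, ← mul_div_assoc, ← add_div, div_eq_iff hD'.ne']
  · ring
  · ring
  · linear_combination -ht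

/-- The range of a completely symmetric state on `ℝ² ⊗ ℝ²` contains a symmetric
product vector `x ⊗ x` with `x ≠ 0`. -/
theorem completelySymmetric_two_range_symmetric_product
    (ρ : Matrix (Fin 2 × Fin 2) (Fin 2 × Fin 2) ℝ)
    (hcs : CompletelySymmetric ρ) (hpsd : ρ.PosSemidef) (htr : ρ.trace = 1) :
    ∃ x : Fin 2 → ℝ, x ≠ 0 ∧ ∃ v, ρ.mulVec v = fun p => x p.1 * x p.2 := by
  have h₁ := fun i j k l => (hcs.apply_swap i j k l).1
  have h₂ := fun i j k l => (hcs.apply_swap i j k l).2.1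
  have h₃ := fun i j k l => (hcs.apply_swap i j k l).2.2
  obtain ⟨a, ha⟩ : ∃ a, ρ (0, 0) (0, 0) = a := ⟨_, rfl⟩
  obtain ⟨b, hb⟩ : ∃ b, ρ (0, 0) (0, 1) = b := ⟨_, rfl⟩
  obtain ⟨c, hc⟩ : ∃ c, ρ (0, 0) (1, 1) = c := ⟨_, rfl⟩
  obtain ⟨d, hd⟩ : ∃ d, ρ (0, 1) (1, 1) = d := ⟨_, rfl⟩
  obtain ⟨e, he⟩ : ∃ e, ρ (1, 1) (1, 1) = e := ⟨_, rfl⟩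
  have b₁ : ρ (0, 0) (1, 0) = b := by rw [h₂, hb]
  have b₂ : ρ (1, 0) (0, 0) = b := by rw [h₃, b₁]
  have b₃ : ρ (0, 1) (0, 0) = b := by rw [h₁, b₂]
  have c₁ : ρ (1, 0) (0, 1) = c := by rw [h₃, hc]
  have c₂ : ρ (1, 0) (1, 0) = c := by rw [h₂, c₁]
  have c₃ : ρ (0, 1) (0, 1) = c := by rw [h₁, c₁]
  have c₄ : ρ (0, 1) (1, 0) = c := by rw [h₁, c₂]
  have c₅ : ρ (1, 1) (0, 0) = c := by rw [h₃, c₄]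
  have d₁ : ρ (1, 0) (1, 1) = d := by rw [h₁, hd]
  have d₂ : ρ (1, 1) (0, 1) = d := by rw [h₃, hd]
  have d₃ : ρ (1, 1) (1, 0) = d := by rw [h₂, d₂]
  have a_nonneg : 0 ≤ a := ha ▸ hpsd.diag_nonneg
  have hbb : b * b ≤ a * c := by
    simpa only [ha, hb, b₃, c₃] using hpsd.mul_apply_le (0, 0) (0, 1)
  have hcc : c * c ≤ a * e := by
    simpa only [ha, hc, c₅, he] using hpsd.mul_apply_le (0, 0) (1, 1)
  have hdd : d * d ≤ c * e := by
    simpa only [c₃, hd, d₂, he] using hpsd.mul_apply_le (0, 1) (1, 1)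
  have htr' : a + c + c + e = 1 := by
    simpa [Matrix.trace, Fintype.sum_prod_type, ha, c₂, c₃, he, add_assoc] using htr
  suffices h : ∃ s t u v w : ℝ, (s ≠ 0 ∨ t ≠ 0) ∧ a * u + b * v + c * w = s * s ∧
      b * u + c * v + d * w = s * t ∧ c * u + d * v + e * w = t * t by
    obtain ⟨s, t, u, v, w, hst, e₁, e₂, e₃⟩ := h
    refine ⟨![s, t], ?_, fun p => !![u, v; 0, w] p.1 p.2, ?_⟩
    · intro h
      have hs := congrFun h 0
      have ht := congrFun h 1
      simp_all
    · ext ⟨i, j⟩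
      fin_cases i <;> fin_cases j <;>
        simp [Matrix.mulVec, dotProduct, Fintype.sum_prod_type, mul_comm t s, *]
  rcases a_nonneg.eq_or_lt with rfl | a_pos
  · have hc0 : c = 0 := by nlinarith
    have hb0 : b = 0 := by nlinarith
    subst hc0
    have hd0 : d = 0 := by nlinarith
    exact ⟨0, 1, 0, 0, 1, by simp, by simp, by simp [hd0], by linarith⟩
  rcases hbb.eq_or_lt with hbb | hbb
  · refine ⟨1, b / a, 1 / a, 0, 0, by simp, ?_, ?_, ?_⟩ <;> field_simp <;> linarith
  · obtain ⟨t, u, v, e₁, e₂, e₃⟩ := exists_hankel_moment (d := d) hbb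
    exact ⟨1, t, u, v, 0, by simp, by linarith, by linarith, by linarith⟩
end

section
/- Every completely symmetric state on ℝ² ⊗ ℝ² is S-separable. -/
open Matrix
open Kronecker
open scoped BigOperators

/-- A degree-four truncated moment sequence whose Hankel form is nonnegative is represented by
at most two real atoms and one atom at infinity. -/
theorem exists_atoms_of_hankel_nonneg (m₀ m₁ m₂ m₃ m₄ : ℝ)
    (h : ∀ x y z : ℝ, 0 ≤ m₀ * x ^ 2 + 2 * m₁ * (x * y) + m₂ * (y ^ 2 + 2 * (x * z))
      + 2 * m₃ * (y * z) + m₄ * z ^ 2) :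
    ∃ u v w r s : ℝ, 0 ≤ u ∧ 0 ≤ v ∧ 0 ≤ w ∧ m₀ = u + v ∧ m₁ = u * r + v * s ∧
      m₂ = u * r ^ 2 + v * s ^ 2 ∧ m₃ = u * r ^ 3 + v * s ^ 3 ∧
      m₄ = u * r ^ 4 + v * s ^ 4 + w := by
  have eq_zero : ∀ b c : ℝ, (∀ t : ℝ, 0 ≤ c * (t * t) + 2 * b * t + 0) → b = 0 := by
    intro b c hb
    have := discrim_le_zero hb
    rw [discrim] at this
    nlinarith
  have h₀ : 0 ≤ m₀ := by simpa using h 1 0 0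
  have h₄ : 0 ≤ m₄ := by simpa using h 0 0 1
  rcases h₀.eq_or_lt with rfl | h₀
  · have e₁ : m₁ = 0 := eq_zero m₁ m₂ fun t => by have := h 1 t 0; linarith
    have e₂ : m₂ = 0 := eq_zero m₂ m₄ fun t => by have := h 1 0 t; linarith
    subst e₁ e₂
    have e₃ : m₃ = 0 := eq_zero m₃ m₄ fun t => by have := h 0 1 t; linarith
    exact ⟨0, 0, m₄, 0, 0, le_rfl, le_rfl, h₄, by simp [e₃]⟩
  obtain ⟨μ, rfl⟩ : ∃ μ, m₁ = m₀ * μ := ⟨m₁ / m₀, by field_simp⟩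
  have hD : 0 ≤ m₂ - m₀ * μ ^ 2 := by have := h (-μ) 1 0; linarith
  rcases hD.eq_or_lt with hD | hD
  · obtain rfl : m₂ = m₀ * μ ^ 2 := by linarith
    have e₃ : m₃ - m₀ * μ ^ 3 = 0 := eq_zero _ m₄ fun t => by
      have := h (-μ) 1 t; linarith
    obtain rfl : m₃ = m₀ * μ ^ 3 := by linarith
    refine ⟨m₀, 0, m₄ - m₀ * μ ^ 4, μ, 0, h₀.le, le_rfl, ?_, by simp⟩
    have := h (-μ ^ 2) 0 1
    linarith
  obtain ⟨c₁, hc₁⟩ : ∃ c₁, m₃ - μ * m₂ + c₁ * (m₂ - m₀ * μ ^ 2) = 0 :=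
    ⟨-(m₃ - μ * m₂) / (m₂ - m₀ * μ ^ 2), by rw [div_mul_cancel₀ _ hD.ne']; ring⟩
  obtain ⟨c₀, hc₀⟩ : ∃ c₀, m₂ + c₁ * (m₀ * μ) + c₀ * m₀ = 0 :=
    ⟨-(m₂ + c₁ * (m₀ * μ)) / m₀, by field_simp; ring⟩
  have hc₀' : m₃ + c₁ * m₂ + c₀ * (m₀ * μ) = 0 := by linear_combination hc₁ + μ * hc₀
  have hneg : μ ^ 2 + c₁ * μ + c₀ < 0 := by
    have : m₀ * (μ ^ 2 + c₁ * μ + c₀) < 0 := by linarith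
    exact (pos_iff_neg_of_mul_neg this).1 h₀
  have hdisc : 0 < c₁ ^ 2 - 4 * c₀ := by nlinarith [sq_nonneg (2 * μ + c₁)]
  obtain ⟨d, hd, hd2⟩ : ∃ d : ℝ, 0 < d ∧ d ^ 2 = c₁ ^ 2 - 4 * c₀ :=
    ⟨√(c₁ ^ 2 - 4 * c₀), Real.sqrt_pos.2 hdisc, Real.sq_sqrt hdisc.le⟩
  obtain ⟨r, hr⟩ : ∃ r, r = (-c₁ + d) / 2 := ⟨_, rfl⟩
  obtain ⟨s, hs⟩ : ∃ s, s = (-c₁ - d) / 2 := ⟨_, rfl⟩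
  obtain rfl : c₁ = -(r + s) := by linarith
  obtain rfl : d = r - s := by linarith
  obtain rfl : c₀ = r * s := by linarith
  have hprod : (μ - r) * (μ - s) < 0 := by linarith
  have hμr : μ < r := by by_contra! hμ; nlinarith
  have hsμ : s < μ := by by_contra! hμ; nlinarith
  obtain ⟨u, hu⟩ : ∃ u, u = m₀ * (μ - s) / (r - s) := ⟨_, rfl⟩
  obtain ⟨v, hv⟩ : ∃ v, v = m₀ * (r - μ) / (r - s) := ⟨_, rfl⟩
  have e₀ : m₀ = u + v := by rw [hu, hv]; field_simp; ring
  have e₁ : m₀ * μ = u * r + v * s := by rw [hu, hv]; field_simp; ring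
  have e₂ : m₂ = u * r ^ 2 + v * s ^ 2 := by
    linear_combination hc₀ + (r + s) * e₁ - r * s * e₀
  have e₃ : m₃ = u * r ^ 3 + v * s ^ 3 := by
    linear_combination hc₀' + (r + s) * e₂ - r * s * e₁
  refine ⟨u, v, m₄ - (r + s) * m₃ + r * s * m₂, r, s, ?_, ?_, ?_, e₀, e₁, e₂, e₃, ?_⟩
  · rw [hu]; exact div_nonneg (mul_nonneg h₀.le (by linarith)) hd.le
  · rw [hv]; exact div_nonneg (mul_nonneg h₀.le (by linarith)) hd.le
  · have := h (r * s) (-(r + s)) 1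
    linear_combination this + r * s * hc₀ - (r + s) * hc₀'
  · linear_combination (r + s) * e₃ - r * s * e₂

/-- The entries of a completely symmetric matrix on `ℝ² ⊗ ℝ²` depend only on the number of
indices equal to `1`. -/
theorem CompletelySymmetric.exists_moments {ρ : Matrix (Fin 2 × Fin 2) (Fin 2 × Fin 2) ℝ}
    (hcs : CompletelySymmetric ρ) :
    ∃ m : ℕ → ℝ, ∀ i j k l : Fin 2, ρ (i, k) (j, l) = m (i + j + k + l : ℕ) := by
  have h₁ (i j k l : Fin 2) : ρ (j, k) (i, l) = ρ (i, k) (j, l) :=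
    hcs (Equiv.swap 0 1) ![i, j, k, l]
  have h₂ (i j k l : Fin 2) : ρ (k, i) (j, l) = ρ (i, k) (j, l) :=
    hcs (Equiv.swap 0 2) ![i, j, k, l]
  have h₃ (i j k l : Fin 2) : ρ (l, k) (j, i) = ρ (i, k) (j, l) :=
    hcs (Equiv.swap 0 3) ![i, j, k, l]
  refine ⟨fun n => if n = 0 then ρ (0, 0) (0, 0) else if n = 1 then ρ (1, 0) (0, 0)
    else if n = 2 then ρ (1, 1) (0, 0) else if n = 3 then ρ (1, 1) (1, 0)
    else ρ (1, 1) (1, 1), ?_⟩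
  simp only [Fin.forall_fin_two] at h₁ h₂ h₃ ⊢
  simp
  grind

/-- Every completely symmetric state on `ℝ² ⊗ ℝ²` is S-separable. -/
theorem completelySymmetric_two_sSeparable
    (ρ : Matrix (Fin 2 × Fin 2) (Fin 2 × Fin 2) ℝ)
    (hcs : CompletelySymmetric ρ) (hpsd : ρ.PosSemidef) (htr : ρ.trace = 1) :
    SSeparable ρ := by
  obtain ⟨m, hm⟩ := hcs.exists_moments
  obtain ⟨u, v, w, r, s, hu, hv, hw, e₀, e₁, e₂, e₃, e₄⟩ :=
    exists_atoms_of_hankel_nonneg (m 0) (m 1) (m 2) (m 3) (m 4) fun x y z => by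
      have := hpsd.dotProduct_mulVec_nonneg fun p => !![x, y / 2; y / 2, z] p.1 p.2
      simp [dotProduct, mulVec, Fintype.sum_prod_type, hm] at this
      linarith
  have root (a : ℝ) (ha : 0 ≤ a) : ∃ b : ℝ, b ^ 4 = a :=
    ⟨√√a, by rw [show 4 = 2 * 2 from rfl, pow_mul, Real.sq_sqrt (by positivity), Real.sq_sqrt ha]⟩
  obtain ⟨a, rfl⟩ := root u hu
  obtain ⟨b, rfl⟩ := root v hv
  obtain ⟨c, rfl⟩ := root w hw
  refine ⟨3, ![![a, a * r], ![b, b * s], ![0, c]], ?_⟩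
  ext ⟨i, k⟩ ⟨j, l⟩
  rw [hm, Matrix.sum_apply]
  fin_cases i <;> fin_cases j <;> fin_cases k <;> fin_cases l <;>
    simp [Fin.sum_univ_three, vecMulVec_apply, e₀, e₁, e₂, e₃, e₄] <;> ring
end

section
/- Every completely symmetric state of rank 3 on ℝ^N ⊗ ℝ^N is S-separable. -/
open Matrix
open Kronecker
open scoped BigOperators

open scoped InnerProductSpace

section RealInner

variable {E F : Type*} [AddCommGroup E] [Module ℝ E]
  [NormedAddCommGroup F] [InnerProductSpace ℝ F]

/-- A linear map `A` that is symmetric relative to `G` factors as `A = T ∘ G` with `T` symmetric. -/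
theorem exists_isSymmetric_comp_eq [FiniteDimensional ℝ F] (G A : E →ₗ[ℝ] F) (hker : ∀ y, G y = 0 → A y = 0)
    (hsymm : ∀ y w, ⟪A y, G w⟫_ℝ = ⟪G y, A w⟫_ℝ) :
    ∃ T : F →ₗ[ℝ] F, T.IsSymmetric ∧ ∀ y, T (G y) = A y := by
  obtain ⟨s, hs⟩ := G.rangeRestrict.exists_rightInverse_of_surjective G.range_rangeRestrict
  have hGs : ∀ p : G.range, G (s p) = p := fun p =>
    congrArg Subtype.val (LinearMap.congr_fun hs p)
  let P : F →ₗ[ℝ] F := G.range.starProjection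
  let R : F →ₗ[ℝ] F := A ∘ₗ s ∘ₗ (G.range.orthogonalProjectionOnto : F →ₗ[ℝ] G.range)
  have hPmem : ∀ u, ∃ y, G y = P u := fun u =>
    LinearMap.mem_range.1 (G.range.starProjection_apply_mem u)
  have hPG : ∀ y, P (G y) = G y := fun y =>
    Submodule.starProjection_eq_self_iff.2 (LinearMap.mem_range_self G y)
  have hRG : ∀ y, R (G y) = A y := by
    intro y
    have h : G (s (G.range.orthogonalProjectionOnto (G y)) - y) = 0 := by
      rw [map_sub, hGs, sub_eq_zero]
      exact hPG y
    have := hker _ h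
    rw [map_sub, sub_eq_zero] at this
    exact this
  have hRP : ∀ u, R (P u) = R u := by
    intro u
    obtain ⟨y, hy⟩ := hPmem u
    have h : G.range.orthogonalProjectionOnto (P u) = G.range.orthogonalProjectionOnto u :=
      Subtype.ext (by rw [← hy]; exact (hPG y).trans hy)
    change A (s (G.range.orthogonalProjectionOnto (P u))) = _
    rw [h]
    rfl
  refine ⟨R + R.adjoint ∘ₗ (LinearMap.id - P), ?_, ?_⟩
  · intro u w
    obtain ⟨y, hy⟩ := hPmem u
    obtain ⟨z, hz⟩ := hPmem w
    have h := hsymm y z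
    rw [← hRG, ← hRG, hy, hz, hRP, hRP] at h
    simp only [LinearMap.add_apply, LinearMap.comp_apply, LinearMap.sub_apply,
      LinearMap.id_apply, inner_add_left, inner_add_right, LinearMap.adjoint_inner_left,
      LinearMap.adjoint_inner_right, inner_sub_left, inner_sub_right]
    linarith
  · intro y
    simp [hPG, hRG]

variable [FiniteDimensional ℝ E]

/-- Some slice `v e` of a completely symmetric bilinear map has the smallest possible kernel. -/
theorem exists_ker_le_ker (v : E →ₗ[ℝ] E →ₗ[ℝ] F) (hv : ∀ x y, v x y = v y x)
    (h : ∀ x y z w, ⟪v x y, v z w⟫_ℝ = ⟪v z y, v x w⟫_ℝ) :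
    ∃ e, ∀ w, v e w = 0 → v w = 0 := by
  obtain ⟨_, ⟨e, rfl⟩, hmin⟩ := wellFounded_lt.has_min
    (Set.range fun x => LinearMap.ker (v x)) ⟨_, 0, rfl⟩
  refine ⟨e, fun w hw => ?_⟩
  have horth : ∀ y z, ⟪v w y, v e z⟫_ℝ = 0 := by
    intro y z
    rw [hv w y, h, hv y, ← hv y, hw, inner_zero_left]
  have hsplit : ∀ z, v (e + w) z = 0 → v e z = 0 ∧ v w z = 0 := by
    intro z hz
    rw [map_add, LinearMap.add_apply] at hz
    have h0 := horth z z
    have h1 : ⟪v e z + v w z, v e z⟫_ℝ = 0 := by rw [hz, inner_zero_left]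
    rw [inner_add_left, h0, add_zero, inner_self_eq_zero] at h1
    exact ⟨h1, by simpa [h1] using hz⟩
  have hle : LinearMap.ker (v e) ≤ LinearMap.ker (v (e + w)) := by
    by_contra hnot
    refine hmin _ ⟨e + w, rfl⟩ (lt_of_le_not_ge (fun z hz => (hsplit z hz).1) hnot)
  have hww : v w w = 0 := (hsplit w (hle hw)).2
  ext y
  rw [LinearMap.zero_apply, ← inner_self_eq_zero (𝕜 := ℝ)]
  nth_rewrite 2 [hv w y]
  rw [h, hww, inner_zero_right]

/-- In dimension at most three, a completely symmetric bilinear map is multiplication by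
commuting symmetric operators applied to a single vector. -/
theorem exists_commute_isSymmetric [FiniteDimensional ℝ F] (hF : Module.finrank ℝ F ≤ 3)
    (v : E →ₗ[ℝ] E →ₗ[ℝ] F) (hv : ∀ x y, v x y = v y x)
    (h : ∀ x y z w, ⟪v x y, v z w⟫_ℝ = ⟪v z y, v x w⟫_ℝ) :
    ∃ (T : E → F →ₗ[ℝ] F) (u : F), (∀ x, (T x).IsSymmetric) ∧
      (∀ x z, Commute (T x) (T z)) ∧ ∀ x y, v x y = T x (T y u) := by
  obtain ⟨e, he⟩ := exists_ker_le_ker v hv h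
  suffices ∃ T : E → F →ₗ[ℝ] F, (∀ x, (T x).IsSymmetric) ∧
      (∀ x z, Commute (T x) (T z)) ∧ ∀ x y, T x (v e y) = v x y by
    obtain ⟨T, hT, hc, hTv⟩ := this
    refine ⟨T, v e e, hT, hc, fun x y => ?_⟩
    rw [hTv, hv y e, hTv]
  have hext : ∀ x, ∃ T : F →ₗ[ℝ] F, T.IsSymmetric ∧ ∀ y, T (v e y) = v x y := fun x =>
    exists_isSymmetric_comp_eq (v e) (v x)
      (fun y hy => by rw [hv, he y hy, LinearMap.zero_apply]) (fun y w => h x y e w)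
  choose T hT hTv using hext
  by_cases hW : (v e).range = ⊤
  · refine ⟨T, hT, fun x z => LinearMap.ext fun a => ?_, hTv⟩
    refine ext_inner_right ℝ fun b => ?_
    obtain ⟨y, rfl⟩ := LinearMap.range_eq_top.1 hW a
    obtain ⟨w, rfl⟩ := LinearMap.range_eq_top.1 hW b
    rw [Module.End.mul_apply, Module.End.mul_apply, hTv, hTv, hT x, hT z, hTv, hTv]
    exact h z y x w
  · obtain ⟨f, hf⟩ : ∃ f, ∀ x, ∃ a b : ℝ, v e x = a • v e e + b • v e f := by
      by_cases hee : v e e = 0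
      · refine ⟨0, fun x => ⟨0, 0, ?_⟩⟩
        rw [he e hee]
        simp
      let g : (v e).range := ⟨v e e, LinearMap.mem_range_self _ e⟩
      have hg : g ≠ 0 := fun hg => hee (congrArg Subtype.val hg)
      have hlt := Submodule.finrank_lt hW
      have hsum := (ℝ ∙ g).finrank_quotient_add_finrank
      rw [finrank_span_singleton hg] at hsum
      obtain ⟨q, hq⟩ := finrank_le_one_iff.1
        (show Module.finrank ℝ ((v e).range ⧸ (ℝ ∙ g)) ≤ 1 by omega)
      obtain ⟨⟨_, f, rfl⟩, rfl⟩ := Submodule.Quotient.mk_surjective _ q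
      refine ⟨f, fun x => ?_⟩
      obtain ⟨b, hb⟩ := hq (Submodule.Quotient.mk ⟨v e x, LinearMap.mem_range_self _ x⟩)
      rw [← Submodule.Quotient.mk_smul, eq_comm, Submodule.Quotient.eq,
        Submodule.mem_span_singleton] at hb
      obtain ⟨a, ha⟩ := hb
      have := congrArg Subtype.val ha
      simp only [g, Submodule.coe_smul, Submodule.coe_sub] at this
      exact ⟨a, b, by rw [this]; abel⟩
    choose a b hab using hf
    refine ⟨fun x => a x • LinearMap.id + b x • T f, fun x => ?_, fun x z => ?_, fun x y => ?_⟩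
    · exact (LinearMap.IsSymmetric.id.smul (by simp)).add ((hT f).smul (by simp))
    · refine LinearMap.ext fun p => ?_
      simp only [Module.End.mul_apply, LinearMap.add_apply, LinearMap.smul_apply,
        LinearMap.id_apply, map_add, map_smul]
      module
    · have hx : v (x - (a x • e + b x • f)) = 0 := he _ (by simp [hab x])
      have hxy := LinearMap.congr_fun hx y
      simp only [map_sub, map_add, map_smul, LinearMap.sub_apply, LinearMap.add_apply,
        LinearMap.smul_apply, LinearMap.zero_apply, sub_eq_zero] at hxy
      simp [hxy, hTv]

/-- In dimension at most three, the Gram tensor of a completely symmetric bilinear map is a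
nonnegative combination of fourth powers of functionals. -/
theorem exists_inner_eq_sum_fourth_powers [FiniteDimensional ℝ F] (hF : Module.finrank ℝ F ≤ 3)
    (v : E →ₗ[ℝ] E →ₗ[ℝ] F) (hv : ∀ x y, v x y = v y x)
    (h : ∀ x y z w, ⟪v x y, v z w⟫_ℝ = ⟪v z y, v x w⟫_ℝ) :
    ∃ (s : Finset (E → ℝ)) (c : (E → ℝ) → ℝ), (∀ χ, 0 ≤ c χ) ∧
      ∀ x y z w, ⟪v x y, v z w⟫_ℝ = ∑ χ ∈ s, c χ * (χ x * χ y * χ z * χ w) := by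
  obtain ⟨T, u, hT, hc, hTv⟩ := exists_commute_isSymmetric hF v hv h
  have hmem : u ∈ ⨆ χ : E → ℝ, ⨅ x, Module.End.eigenspace (T x) (χ x) := by
    rw [LinearMap.IsSymmetric.iSup_iInf_eq_top_of_commute hT fun x z _ => hc x z]
    trivial
  obtain ⟨p, hp, hsum⟩ := (Submodule.mem_iSup_iff_exists_finsupp _ _).1 hmem
  have heig : ∀ χ x, T x (p χ) = χ x • p χ := fun χ x =>
    Module.End.mem_eigenspace_iff.1 (Submodule.mem_iInf _ |>.1 (hp χ) x)
  have horth : ∀ χ ψ, χ ≠ ψ → ⟪p χ, p ψ⟫_ℝ = 0 := fun χ ψ hne =>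
    LinearMap.IsSymmetric.orthogonalFamily_iInf_eigenspaces hT hne ⟨_, hp χ⟩ ⟨_, hp ψ⟩
  have hvp : ∀ x y, v x y = ∑ χ ∈ p.support, (χ x * χ y) • p χ := by
    intro x y
    rw [hTv, ← hsum, Finsupp.sum, map_sum, map_sum]
    refine Finset.sum_congr rfl fun χ _ => ?_
    rw [heig, map_smul, heig, smul_smul, mul_comm]
  refine ⟨p.support, fun χ => ⟪p χ, p χ⟫_ℝ, fun χ => real_inner_self_nonneg, fun x y z w => ?_⟩
  rw [hvp, hvp, sum_inner]
  refine Finset.sum_congr rfl fun χ hχ => ?_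
  rw [inner_sum, Finset.sum_eq_single_of_mem χ hχ]
  · rw [real_inner_smul_left, real_inner_smul_right]
    ring
  · intro ψ _ hne
    rw [real_inner_smul_left, real_inner_smul_right, horth χ ψ hne.symm]
    ring

end RealInner

open scoped MatrixOrder in
/-- A positive semidefinite matrix is the Gram matrix of vectors in a space whose dimension is
its rank; on product indices the Gram vectors extend to a bilinear map. -/
theorem exists_bilinear_gram {m n : Type*} [Fintype m] [Fintype n] [DecidableEq m] [DecidableEq n]
    {ρ : Matrix (m × n) (m × n) ℝ} (hρ : ρ.PosSemidef) :
    ∃ (F : Submodule ℝ (EuclideanSpace ℝ (m × n)))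
      (v : (m → ℝ) →ₗ[ℝ] (n → ℝ) →ₗ[ℝ] F), Module.finrank ℝ F = ρ.rank ∧
      ∀ x y z w, ⟪v x y, v z w⟫_ℝ =
        ∑ t : (m × n) × (m × n), x t.1.1 * y t.1.2 * (z t.2.1 * w t.2.2) * ρ t.1 t.2 := by
  obtain ⟨B, rfl⟩ := CStarAlgebra.nonneg_iff_eq_star_mul_self.mp hρ.nonneg
  have hrange : Module.finrank ℝ (toLpLin 2 2 B).range = B.rank := by
    rw [toLpLin_eq_toLin]
    exact (B.rank_eq_finrank_range_toLin _ _).symm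
  refine ⟨(toLpLin 2 2 B).range, LinearMap.mk₂ ℝ
    (fun x y => (toLpLin 2 2 B).rangeRestrict (WithLp.toLp 2 fun p => x p.1 * y p.2))
    (fun x x' y => ?_) (fun a x y => ?_) (fun x y y' => ?_) (fun a x y => ?_),
    hrange.trans (B.rank_conjTranspose_mul_self).symm, fun x y z w => ?_⟩
  · rw [← map_add]
    congr 1
    ext p
    simp [add_mul]
  · rw [← map_smul]
    congr 1
    ext p
    simp [mul_assoc]
  · rw [← map_add]
    congr 1
    ext p
    simp [mul_add]
  · rw [← map_smul]
    congr 1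
    ext p
    simp [mul_left_comm]
  · have hsum (f g : m × n → ℝ) : ∑ r, (∑ q, B r q * g q) * ∑ p, B r p * f p =
        ∑ p, ∑ q, f p * g q * ∑ r, B r p * B r q := by
      simp_rw [mul_comm (∑ q, _ * g q), Fintype.sum_mul_sum, Finset.mul_sum]
      rw [Finset.sum_comm]
      refine Finset.sum_congr rfl fun p _ => ?_
      rw [Finset.sum_comm]
      refine Finset.sum_congr rfl fun q _ => Finset.sum_congr rfl fun r _ => ?_
      ring
    rw [Fintype.sum_prod_type]
    exact hsum (fun p => x p.1 * y p.2) (fun p => z p.1 * w p.2)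

/-- A nonnegative combination of fourth powers is S-separable. -/
theorem sSeparable_of_sum_fourth_powers {N : ℕ} {α : Type*}
    {ρ : Matrix (Fin N × Fin N) (Fin N × Fin N) ℝ}
    (s : Finset α) (c : α → ℝ) (hc : ∀ a, 0 ≤ c a) (x : α → Fin N → ℝ)
    (h : ∀ i j k l, ρ (i, k) (j, l) = ∑ a ∈ s, c a * (x a i * x a k * x a j * x a l)) :
    SSeparable ρ := by
  refine ⟨s.card, fun t => √√(c (s.equivFin.symm t)) • x (s.equivFin.symm t), ?_⟩
  ext ⟨i, k⟩ ⟨j, l⟩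
  rw [h, ← Finset.sum_coe_sort, ← s.equivFin.symm.sum_comp, Matrix.sum_apply]
  refine Finset.sum_congr rfl fun t _ => ?_
  simp only [kroneckerMap_apply, vecMulVec_apply, Pi.smul_apply, smul_eq_mul]
  set a : α := (s.equivFin.symm t : α)
  have h4 : √√(c a) * √√(c a) * (√√(c a) * √√(c a)) = c a := by
    rw [Real.mul_self_sqrt (Real.sqrt_nonneg _), Real.mul_self_sqrt (hc a)]
  linear_combination (-(x a i * x a k * x a j * x a l)) * h4

/-- Every completely symmetric state of rank 3 is S-separable. -/
theorem completelySymmetric_rank_three_sSeparable {N : ℕ}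
    (ρ : Matrix (Fin N × Fin N) (Fin N × Fin N) ℝ)
    (hcs : CompletelySymmetric ρ) (hpsd : ρ.PosSemidef) (htr : ρ.trace = 1)
    (hrank : ρ.rank = 3) :
    SSeparable ρ := by
  obtain ⟨F, v, hF, hv⟩ := exists_bilinear_gram hpsd
  have h02 : ∀ i j k l, ρ (k, i) (j, l) = ρ (i, k) (j, l) := fun i j k l =>
    hcs (Equiv.swap 0 2) ![i, j, k, l]
  have h01 : ∀ i j k l, ρ (j, k) (i, l) = ρ (i, k) (j, l) := fun i j k l =>
    hcs (Equiv.swap 0 1) ![i, j, k, l]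
  have hswap : ∀ x y z w, ⟪v x y, v z w⟫_ℝ = ⟪v y x, v z w⟫_ℝ := by
    intro x y z w
    rw [hv, hv]
    refine Fintype.sum_equiv ⟨fun t => ((t.1.2, t.1.1), t.2), fun t => ((t.1.2, t.1.1), t.2),
      fun _ => rfl, fun _ => rfl⟩ _ _ fun t => ?_
    simp only [Equiv.coe_fn_mk]
    rw [h02, mul_comm (x _)]
  have hexch : ∀ x y z w, ⟪v x y, v z w⟫_ℝ = ⟪v z y, v x w⟫_ℝ := by
    intro x y z w
    rw [hv, hv]
    refine Fintype.sum_equiv ⟨fun t => ((t.2.1, t.1.2), (t.1.1, t.2.2)),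
      fun t => ((t.2.1, t.1.2), (t.1.1, t.2.2)), fun _ => rfl, fun _ => rfl⟩ _ _ fun t => ?_
    simp only [Equiv.coe_fn_mk]
    rw [h01]
    ring
  have hsymm : ∀ x y, v x y = v y x := by
    intro x y
    rw [← sub_eq_zero, ← inner_self_eq_zero (𝕜 := ℝ), inner_sub_left, inner_sub_right,
      inner_sub_right, hswap x y, hswap x y]
    ring
  obtain ⟨s, c, hc, hsum⟩ :=
    exists_inner_eq_sum_fourth_powers (hF.trans hrank).le v hsymm hexch
  refine sSeparable_of_sum_fourth_powers s c hc (fun χ i => χ (Pi.single i 1)) fun i j k l => ?_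
  rw [← hsum, hv, Finset.sum_eq_single_of_mem ((i, k), (j, l)) (Finset.mem_univ _)]
  · simp
  · rintro ⟨⟨i', k'⟩, ⟨j', l'⟩⟩ _ hne
    simp only [Pi.single_apply, ne_eq, Prod.mk.injEq] at hne ⊢
    grind
end

section
/- Let ρ be a completely symmetric state supported on ℝ^N ⊗ ℝ^N. If N ≤ 2 or rank(ρ) ≤ N, then ρ is S-separable. -/
open Matrix
open Kronecker
open scoped BigOperators

section QuarticForm

open scoped InnerProductSpace

variable {V W ι : Type*} [AddCommGroup V] [Module ℝ V]
  [NormedAddCommGroup W] [InnerProductSpace ℝ W]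

/-- A bilinear map `B` into an inner product space is a symmetric Gram factorization if
`(a, b, c, d) ↦ ⟪B a b, B c d⟫` is a totally symmetric quartic form and `B` is symmetric. -/
structure IsSymmGram (B : V →ₗ[ℝ] V →ₗ[ℝ] W) : Prop where
  comm : ∀ a b, B a b = B b a
  swap : ∀ a b c d, ⟪B a b, B c d⟫_ℝ = ⟪B c b, B a d⟫_ℝ

/-- If `B y` is onto, then the operators `B y v ↦ B z v` are well defined, symmetric and commute;
diagonalizing them simultaneously writes the quartic form as a sum of fourth powers. -/
theorem IsSymmGram.exists_sum_of_surjective [FiniteDimensional ℝ W] {B : V →ₗ[ℝ] V →ₗ[ℝ] W}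
    (hB : IsSymmGram B) {y : V} (hy : Function.Surjective (B y)) (e : ι → V) :
    ∃ (L : ℕ) (x : Fin L → ι → ℝ), ∀ i j k l,
      ⟪B (e i) (e k), B (e j) (e l)⟫_ℝ = ∑ t, x t i * x t j * (x t k * x t l) := by
  classical
  obtain ⟨s, hs⟩ := (B y).exists_rightInverse_of_surjective (LinearMap.range_eq_top.2 hy)
  have hs' (w : W) : B y (s w) = w := LinearMap.congr_fun hs w
  have hker (v z : V) (hv : B y v = 0) : B z v = 0 := by
    obtain ⟨u, hu⟩ := hy (B z v)
    rw [← inner_self_eq_zero (𝕜 := ℝ)]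
    nth_rewrite 2 [← hu]
    rw [hB.swap, hv, inner_zero_left]
  let M (i : ι) : Module.End ℝ W := B (e i) ∘ₗ s
  have hM (i : ι) (v : V) : M i (B y v) = B (e i) v := by
    have := hker (s (B y v) - v) (e i) (by rw [map_sub, hs', sub_self])
    rwa [map_sub, sub_eq_zero] at this
  have hsymm (i : ι) : (M i).IsSymmetric := by
    intro u w
    obtain ⟨u, rfl⟩ := hy u
    obtain ⟨w, rfl⟩ := hy w
    rw [hM, hM, hB.swap]
  have hcomm (i j : ι) : M i * M j = M j * M i := by
    refine LinearMap.ext fun u => ext_inner_right ℝ fun w => ?_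
    obtain ⟨u, rfl⟩ := hy u
    obtain ⟨w, rfl⟩ := hy w
    rw [Module.End.mul_apply, Module.End.mul_apply, hM, hM, hsymm, hsymm, hM, hM, hB.swap]
  have htop := LinearMap.IsSymmetric.iSup_iInf_eq_top_of_commute hsymm fun i j _ => hcomm i j
  have hort := LinearMap.IsSymmetric.orthogonalFamily_iInf_eigenspaces hsymm
  have hmem : B y y ∈ (⨆ χ : ι → ℝ, ⨅ i, (M i).eigenspace (χ i)) := htop ▸ Submodule.mem_top
  obtain ⟨f, hf, hsum⟩ := (Submodule.mem_iSup_iff_exists_finsupp _ _).1 hmem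
  have hMf (i : ι) (χ : ι → ℝ) : M i (f χ) = χ i • f χ :=
    Module.End.mem_eigenspace_iff.1 ((Submodule.mem_iInf _).1 (hf χ) i)
  have hexp (i k : ι) : B (e i) (e k) = ∑ χ ∈ f.support, (χ i * χ k) • f χ := by
    have : B (e i) (e k) = M i (M k (B y y)) := by
      rw [hM, hB.comm (e k), hM]
    rw [this, ← hsum, Finsupp.sum]
    simp only [map_sum, hMf, map_smul, smul_smul]
    exact Finset.sum_congr rfl fun χ _ => by rw [mul_comm]
  have horth (χ ψ : ι → ℝ) (h : χ ≠ ψ) : ⟪f χ, f ψ⟫_ℝ = 0 :=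
    hort h ⟨f χ, hf χ⟩ ⟨f ψ, hf ψ⟩
  refine ⟨_, fun t i => √‖f (f.support.equivFin.symm t)‖ * (f.support.equivFin.symm t).1 i,
    fun i j k l => ?_⟩
  rw [Equiv.sum_comp f.support.equivFin.symm (fun χ : f.support =>
    √‖f χ‖ * χ.1 i * (√‖f χ‖ * χ.1 j) * (√‖f χ‖ * χ.1 k * (√‖f χ‖ * χ.1 l))),
    Finset.sum_coe_sort f.support (fun χ =>
    √‖f χ‖ * χ i * (√‖f χ‖ * χ j) * (√‖f χ‖ * χ k * (√‖f χ‖ * χ l))), hexp, hexp, sum_inner]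
  refine Finset.sum_congr rfl fun χ hχ => ?_
  rw [inner_sum, Finset.sum_eq_single_of_mem χ hχ]
  · rw [inner_smul_left, inner_smul_right, real_inner_self_eq_norm_sq]
    simp only [RCLike.conj_to_real]
    linear_combination (-(χ i * χ k * (χ j * χ l)) * (‖f χ‖ + √‖f χ‖ ^ 2)) *
      Real.sq_sqrt (norm_nonneg (f χ))
  · intro ψ _ hψ
    rw [inner_smul_left, inner_smul_right, horth _ _ hψ.symm]
    simp

variable [FiniteDimensional ℝ V]

/-- If some `x` in the kernel of `B y` is not in the kernel of `B z`, then perturbing `y` in the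
direction `z` increases the rank, since `B z x` is orthogonal to the range of `B y`. -/
theorem IsSymmGram.exists_finrank_range_lt {B : V →ₗ[ℝ] V →ₗ[ℝ] W} (hB : IsSymmGram B)
    {x y z : V} (hx : B y x = 0) (hz : B z x ≠ 0) :
    ∃ y', Module.finrank ℝ (B y).range < Module.finrank ℝ (B y').range := by
  let c := Module.finBasis ℝ (B y).range
  choose v hv using fun i => (c i).2
  let g (ε : ℝ) : Option (Fin (Module.finrank ℝ (B y).range)) → W :=
    fun o => o.casesOn' (B z x) fun i => B (y + ε • z) (v i)
  have hcont : Continuous g := by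
    refine continuous_pi fun o => ?_
    cases o with
    | none => exact continuous_const
    | some i =>
      simp only [g, Option.casesOn'_some, map_add, map_smul, LinearMap.add_apply,
        LinearMap.smul_apply]
      fun_prop
  have hli : LinearIndependent ℝ (g 0) := by
    refine linearIndependent_option'.2 ⟨?_, fun hmem => hz ?_⟩
    · simp only [zero_smul, add_zero, hv]
      exact c.linearIndependent.map' _ (Submodule.ker_subtype _)
    · have hle : Submodule.span ℝ (Set.range fun i => B (y + (0 : ℝ) • z) (v i)) ≤ (B y).range := by
        rw [Submodule.span_le]
        rintro _ ⟨i, rfl⟩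
        exact ⟨v i, by simp⟩
      obtain ⟨u, hu⟩ := hle hmem
      rw [← inner_self_eq_zero (𝕜 := ℝ)]
      nth_rewrite 2 [← hu]
      rw [hB.swap, hx, inner_zero_left]
  have hev := hcont.continuousAt.eventually hli.eventually
  obtain ⟨ε, hε, hne⟩ :=
    ((hev.filter_mono nhdsWithin_le_nhds).and (self_mem_nhdsWithin (s := {(0 : ℝ)}ᶜ))).exists
  refine ⟨y + ε • z, ?_⟩
  have hrange (o) : g ε o ∈ (B (y + ε • z)).range := by
    cases o with
    | none =>
      refine ⟨ε⁻¹ • x, ?_⟩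
      have : ε ≠ 0 := hne
      simp [g, hx, smul_smul, this]
    | some i => exact ⟨v i, rfl⟩
  have hli' : LinearIndependent ℝ fun o => (⟨g ε o, hrange o⟩ : (B (y + ε • z)).range) :=
    LinearIndependent.of_comp (Submodule.subtype _) hε
  have hcard := hli'.fintype_card_le_finrank
  rwa [Fintype.card_option, Fintype.card_fin] at hcard

theorem IsSymmGram.exists_injective {B : V →ₗ[ℝ] V →ₗ[ℝ] W} (hB : IsSymmGram B)
    (hnd : ∀ x, (∀ z, B z x = 0) → x = 0) : ∃ y, Function.Injective (B y) := by
  have hbdd : BddAbove (Set.range fun y => Module.finrank ℝ (B y).range) :=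
    ⟨Module.finrank ℝ V, by rintro _ ⟨y, rfl⟩; exact LinearMap.finrank_range_le _⟩
  obtain ⟨y, hy⟩ := Nat.sSup_mem (Set.range_nonempty _) hbdd
  refine ⟨y, (injective_iff_map_eq_zero _).2 fun x hx => hnd x fun z => ?_⟩
  by_contra hz
  obtain ⟨y', hy'⟩ := hB.exists_finrank_range_lt hx hz
  exact (le_csSup hbdd ⟨y', rfl⟩).not_gt (hy ▸ hy')

/-- It suffices that the defect of `B` from taking values in the range of `B y` be a single fourth
power. -/
theorem IsSymmGram.exists_sum_of_defect {B : V →ₗ[ℝ] V →ₗ[ℝ] W} (hB : IsSymmGram B)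
    (y : V) (μ : V →ₗ[ℝ] ℝ) (w : W)
    (hdef : ∀ a b, B a b - (B y).range.starProjection (B a b) = (μ a * μ b) • w) (e : ι → V) :
    ∃ (L : ℕ) (x : Fin L → ι → ℝ), ∀ i j k l,
      ⟪B (e i) (e k), B (e j) (e l)⟫_ℝ = ∑ t, x t i * x t j * (x t k * x t l) := by
  let P := (B y).range.orthogonalProjectionOnto
  let B' : V →ₗ[ℝ] V →ₗ[ℝ] (B y).range := B.compr₂ P.toLinearMap
  have hinner (a b c d : V) :
      ⟪B' a b, B' c d⟫_ℝ = ⟪B a b, B c d⟫_ℝ - μ a * μ b * (μ c * μ d) * ‖w‖ ^ 2 := by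
    have hproj (u v : W) : ⟪P u, P v⟫_ℝ = ⟪u, v⟫_ℝ -
        ⟪u - (B y).range.starProjection u, v - (B y).range.starProjection v⟫_ℝ := by
      have hu := (B y).range.starProjection_inner_eq_zero u _ (P v).2
      have hv := (B y).range.starProjection_inner_eq_zero v _ (P u).2
      change ⟪(B y).range.starProjection u, (B y).range.starProjection v⟫_ℝ = _
      change ⟪_, (B y).range.starProjection v⟫_ℝ = 0 at hu
      change ⟪_, (B y).range.starProjection u⟫_ℝ = 0 at hv
      rw [real_inner_comm] at hv
      simp only [inner_sub_left, inner_sub_right] at hu hv ⊢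
      linarith
    change ⟪P (B a b), P (B c d)⟫_ℝ = _
    rw [hproj, hdef, hdef, inner_smul_left, inner_smul_right, real_inner_self_eq_norm_sq]
    simp only [RCLike.conj_to_real]
    ring
  have hB' : IsSymmGram B' :=
    ⟨fun a b => congrArg P (hB.comm a b), fun a b c d => by
      rw [hinner, hinner, hB.swap]; ring⟩
  have hsurj : Function.Surjective (B' y) := by
    rintro ⟨_, v, rfl⟩
    exact ⟨v, (B y).range.orthogonalProjectionOnto_mem_subspace_eq_self ⟨B y v, v, rfl⟩⟩
  obtain ⟨L, x, hx⟩ := hB'.exists_sum_of_surjective hsurj e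
  refine ⟨L + 1, Fin.snoc x fun i => √‖w‖ * μ (e i), fun i j k l => ?_⟩
  rw [Fin.sum_univ_castSucc]
  simp only [Fin.snoc_castSucc, Fin.snoc_last]
  rw [← hx, hinner]
  linear_combination (-(μ (e i) * μ (e k) * (μ (e j) * μ (e l))) * (‖w‖ + √‖w‖ ^ 2)) *
    Real.sq_sqrt (norm_nonneg w)

end QuarticForm

section Gram

open scoped InnerProductSpace

variable {N : ℕ}

open scoped MatrixOrder in
theorem Matrix.PosSemidef.exists_eq_conjTranspose_mul_self {n : Type*} [Fintype n]
    [DecidableEq n] {M : Matrix n n ℝ} (hM : M.PosSemidef) : ∃ A : Matrix n n ℝ, M = Aᴴ * A :=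
  CStarAlgebra.nonneg_iff_eq_star_mul_self.1 hM.nonneg

/-- The bilinear map sending `(a, b)` to the image of `a ⊗ b` under `A`. -/
noncomputable def tensorMulVec (A : Matrix (Fin N × Fin N) (Fin N × Fin N) ℝ) :
    (Fin N → ℝ) →ₗ[ℝ] (Fin N → ℝ) →ₗ[ℝ] EuclideanSpace ℝ (Fin N × Fin N) :=
  LinearMap.mk₂ ℝ (fun a b => WithLp.toLp 2 (A *ᵥ fun p => a p.1 * b p.2))
    (fun a a' b => by
      rw [← WithLp.toLp_add, ← mulVec_add]; congr 2; ext p; simp [add_mul])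
    (fun c a b => by
      rw [← WithLp.toLp_smul, ← mulVec_smul]; congr 2; ext p; simp [mul_assoc])
    (fun a b b' => by
      rw [← WithLp.toLp_add, ← mulVec_add]; congr 2; ext p; simp [mul_add])
    (fun c a b => by
      rw [← WithLp.toLp_smul, ← mulVec_smul]; congr 2; ext p; simp [mul_left_comm])

theorem tensorMulVec_single (A : Matrix (Fin N × Fin N) (Fin N × Fin N) ℝ) (i k : Fin N) :
    tensorMulVec A (Pi.single i 1) (Pi.single k 1) = WithLp.toLp 2 (A.col (i, k)) := by
  have : (fun p : Fin N × Fin N => (Pi.single i 1 : Fin N → ℝ) p.1 * (Pi.single k 1 : Fin N → ℝ) p.2)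
      = Pi.single (i, k) 1 := by
    ext ⟨p, q⟩
    simp only [Pi.single_apply, Prod.mk.injEq]
    split_ifs <;> simp_all
  simp only [tensorMulVec, LinearMap.mk₂_apply, this, mulVec_single_one]

theorem inner_tensorMulVec (A : Matrix (Fin N × Fin N) (Fin N × Fin N) ℝ) (a b c d : Fin N → ℝ) :
    ⟪tensorMulVec A a b, tensorMulVec A c d⟫_ℝ =
      ∑ x : (Fin N × Fin N) × (Fin N × Fin N),
        a x.1.1 * b x.1.2 * (c x.2.1 * d x.2.2) * (Aᴴ * A) x.1 x.2 := by
  have h (u v : Fin N × Fin N → ℝ) : ⟪WithLp.toLp 2 (A *ᵥ u), WithLp.toLp 2 (A *ᵥ v)⟫_ℝ =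
      u ⬝ᵥ (Aᴴ * A) *ᵥ v := by
    rw [EuclideanSpace.inner_toLp_toLp, star_trivial, dotProduct_comm, dotProduct_mulVec u,
      ← vecMul_vecMul, conjTranspose_eq_transpose_of_trivial, vecMul_transpose,
      ← dotProduct_mulVec]
  simp only [tensorMulVec, LinearMap.mk₂_apply, h, Fintype.sum_prod_type (α₁ := Fin N × Fin N),
    dotProduct, mulVec, Finset.mul_sum]
  exact Finset.sum_congr rfl fun p _ => Finset.sum_congr rfl fun q _ => by ring

theorem inner_tensorMulVec_single (A : Matrix (Fin N × Fin N) (Fin N × Fin N) ℝ)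
    (i j k l : Fin N) :
    ⟪tensorMulVec A (Pi.single i 1) (Pi.single k 1),
      tensorMulVec A (Pi.single j 1) (Pi.single l 1)⟫_ℝ = (Aᴴ * A) (i, k) (j, l) := by
  rw [tensorMulVec_single, tensorMulVec_single, PiLp.inner_apply, mul_apply]
  simp [mul_comm]

theorem CompletelySymmetric.isSymmGram {A : Matrix (Fin N × Fin N) (Fin N × Fin N) ℝ}
    (h : CompletelySymmetric (Aᴴ * A)) : IsSymmGram (tensorMulVec A) := by
  have hswap02 (i j k l) : (Aᴴ * A) (i, k) (j, l) = (Aᴴ * A) (k, i) (j, l) := by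
    simpa [Equiv.swap_apply_def] using h (Equiv.swap 0 2) ![k, j, i, l]
  have hswap01 (i j k l) : (Aᴴ * A) (i, k) (j, l) = (Aᴴ * A) (j, k) (i, l) := by
    simpa [Equiv.swap_apply_def] using h (Equiv.swap 0 1) ![j, i, k, l]
  refine ⟨fun a b => ?_, fun a b c d => ?_⟩
  · have hinner (c d) : ⟪tensorMulVec A a b, tensorMulVec A c d⟫_ℝ =
        ⟪tensorMulVec A b a, tensorMulVec A c d⟫_ℝ := by
      rw [inner_tensorMulVec, inner_tensorMulVec]
      refine Fintype.sum_equiv ((Equiv.prodComm _ _).prodCongr (Equiv.refl _)) _ _ ?_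
      rintro ⟨⟨i, k⟩, j, l⟩
      change a i * b k * (c j * d l) * _ = b k * a i * (c j * d l) * (Aᴴ * A) (k, i) (j, l)
      rw [hswap02, mul_comm (a i)]
    rw [← sub_eq_zero, ← inner_self_eq_zero (𝕜 := ℝ), inner_sub_right, inner_sub_left,
      inner_sub_left, hinner, hinner]
    simp
  · rw [inner_tensorMulVec, inner_tensorMulVec]
    refine Fintype.sum_equiv (Function.Involutive.toPerm
      (fun x => ((x.2.1, x.1.2), (x.1.1, x.2.2))) fun _ => rfl) _ _ ?_
    rintro ⟨⟨i, k⟩, j, l⟩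
    change a i * b k * (c j * d l) * _ = c j * b k * (a i * d l) * (Aᴴ * A) (j, k) (i, l)
    rw [hswap01]
    ring

theorem eq_zero_of_tensorMulVec_eq_zero {A : Matrix (Fin N × Fin N) (Fin N × Fin N) ℝ}
    (hrank : (reducedMat (Aᴴ * A)).rank = N) {x : Fin N → ℝ}
    (hx : ∀ z, tensorMulVec A x z = 0) : x = 0 := by
  have hsurj : Function.Surjective (reducedMat (Aᴴ * A)).mulVecLin := by
    rw [← LinearMap.range_eq_top]
    exact Submodule.eq_top_of_finrank_eq (by simpa [Matrix.rank] using hrank)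
  refine (injective_iff_map_eq_zero _).1 (LinearMap.injective_iff_surjective.2 hsurj) x ?_
  ext i
  have hsum (k : Fin N) : ∑ j, (Aᴴ * A) (i, k) (j, k) * x j = 0 := by
    have h0 : ⟪tensorMulVec A (Pi.single i 1) (Pi.single k 1),
        tensorMulVec A x (Pi.single k 1)⟫_ℝ = 0 := by rw [hx, inner_zero_right]
    rw [pi_eq_sum_univ' x] at h0
    simpa only [map_sum, map_smul, LinearMap.sum_apply, LinearMap.smul_apply, inner_sum,
      inner_smul_right, ← Pi.single_apply, inner_tensorMulVec_single, mul_comm] using h0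
  simp only [mulVecLin_apply, mulVec, dotProduct, reducedMat, of_apply, Finset.sum_mul,
    Pi.zero_apply]
  rw [Finset.sum_comm]
  exact Finset.sum_eq_zero fun k _ => hsum k

theorem tensorMulVec_mem_range_of_injective (A : Matrix (Fin N × Fin N) (Fin N × Fin N) ℝ)
    (y : Fin N → ℝ) (hy : Function.Injective (tensorMulVec A y)) (hA : A.rank ≤ N)
    (a b : Fin N → ℝ) : tensorMulVec A a b ∈ (tensorMulVec A y).range := by
  let R := A.mulVecLin.range.map (WithLp.linearEquiv 2 ℝ (Fin N × Fin N → ℝ)).symm.toLinearMap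
  have hmem (a b) : tensorMulVec A a b ∈ R := ⟨_, ⟨_, rfl⟩, rfl⟩
  have hle : (tensorMulVec A y).range ≤ R := by
    rintro _ ⟨z, rfl⟩
    exact hmem y z
  have hfin : Module.finrank ℝ R ≤ Module.finrank ℝ (tensorMulVec A y).range := by
    rw [LinearMap.finrank_range_of_inj hy, Module.finrank_fin_fun]
    exact (Submodule.finrank_map_le _ _).trans hA
  rw [Submodule.eq_of_le_of_finrank_le hle hfin]
  exact hmem a b

end Gram

/-- A completely symmetric state supported on `ℝ^N ⊗ ℝ^N` is S-separable whenever
`N ≤ 2` or `rank ρ ≤ N`. -/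
theorem completelySymmetric_supported_sSeparable {N : ℕ}
    (ρ : Matrix (Fin N × Fin N) (Fin N × Fin N) ℝ)
    (hcs : CompletelySymmetric ρ) (hpsd : ρ.PosSemidef) (htr : ρ.trace = 1)
    (hsupp : (reducedMat ρ).rank = N)
    (h : N ≤ 2 ∨ ρ.rank ≤ N) :
    SSeparable ρ := by
  obtain ⟨A, rfl⟩ : ∃ A, ρ = Aᴴ * A := hpsd.exists_eq_conjTranspose_mul_self
  have hB := hcs.isSymmGram
  suffices ∃ (y : Fin N → ℝ) (μ : (Fin N → ℝ) →ₗ[ℝ] ℝ) (w : EuclideanSpace ℝ (Fin N × Fin N)),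
      ∀ a b, tensorMulVec A a b -
      (tensorMulVec A y).range.starProjection (tensorMulVec A a b) = (μ a * μ b) • w by
    obtain ⟨y, μ, w, hdef⟩ := this
    obtain ⟨L, x, hx⟩ := hB.exists_sum_of_defect y μ w hdef fun i => Pi.single i 1
    refine ⟨L, x, ?_⟩
    ext ⟨i, k⟩ ⟨j, l⟩
    simp only [← inner_tensorMulVec_single, hx, Matrix.sum_apply, kroneckerMap_apply, vecMulVec_apply]
  have hcases : N = 2 ∨ A.rank ≤ N := by
    rw [rank_conjTranspose_mul_self] at h
    refine h.elim (fun hN => ?_) Or.inr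
    have := A.rank_le_card_width
    simp only [Fintype.card_prod, Fintype.card_fin] at this
    interval_cases N <;> simp_all
  obtain rfl | hrank := hcases
  · let y : Fin 2 → ℝ := Pi.single 0 1
    let z : Fin 2 → ℝ := Pi.single 1 1
    let Q := LinearMap.id - (tensorMulVec A y).range.starProjection.toLinearMap
    have hQy (a) : Q (tensorMulVec A y a) = 0 := by
      simp only [Q, LinearMap.sub_apply, LinearMap.id_apply, ContinuousLinearMap.coe_coe]
      rw [Submodule.starProjection_eq_self_iff.2 (LinearMap.mem_range_self _ a), sub_self]
    refine ⟨y, LinearMap.proj 1, Q (tensorMulVec A z z), fun a b => ?_⟩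
    have hyz (a : Fin 2 → ℝ) : a = a 0 • y + a 1 • z := by
      ext i; fin_cases i <;> simp [y, z]
    change Q (tensorMulVec A a b) = _
    conv_lhs => rw [hyz a, hyz b]
    simp only [map_add, map_smul, LinearMap.add_apply, LinearMap.smul_apply, hQy,
      hB.comm z y, LinearMap.proj_apply, smul_zero, zero_add, smul_smul, mul_comm]
  · obtain ⟨y, hy⟩ := hB.exists_injective fun x hx =>
      eq_zero_of_tensorMulVec_eq_zero hsupp fun z => (hB.comm x z).trans (hx z)
    refine ⟨y, 0, 0, fun a b => ?_⟩
    rw [Submodule.starProjection_eq_self_iff.2 (tensorMulVec_mem_range_of_injective A y hy hrank a b)]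
    simp
end

section
/- Let ρ be a completely symmetric state on ℝ^N ⊗ ℝ^N and suppose ρ = σ + δ where σ and δ are nonzero real positive semidefinite matrices such that the column space of ρ₁ is the direct sum of the column spaces of σ₁ and δ₁. Then both σ and δ are completely symmetric; moreover, ρ is S-separable if and only if σ and δ are both S-separable. -/
open Matrix
open Kronecker
open scoped BigOperators

/-- Conjugation by `P ⊗ P` preserves complete symmetry. -/
theorem CompletelySymmetric.kronecker_conj {N : ℕ}
    {ρ : Matrix (Fin N × Fin N) (Fin N × Fin N) ℝ} (h : CompletelySymmetric ρ)
    (P : Matrix (Fin N) (Fin N) ℝ) :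
    CompletelySymmetric ((P ⊗ₖ P) * ρ * (P ⊗ₖ P)ᵀ) := by
  have key : ∀ v : Fin 4 → Fin N,
      ((P ⊗ₖ P) * ρ * (P ⊗ₖ P)ᵀ) (v 0, v 2) (v 1, v 3) =
        ∑ u : Fin 4 → Fin N, (∏ m, P (v m) (u m)) * ρ (u 0, u 2) (u 1, u 3) := by
    intro v
    simp only [Matrix.mul_apply, Finset.sum_mul, transpose_apply, kroneckerMap_apply]
    rw [← Fintype.sum_prod_type']
    refine Fintype.sum_equiv
      { toFun := fun x => ![x.2.1, x.1.1, x.2.2, x.1.2]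
        invFun := fun u => ((u 1, u 3), (u 0, u 2))
        left_inv := fun x => rfl
        right_inv := fun u => by ext m; fin_cases m <;> rfl } _ _ ?_
    rintro ⟨⟨a, b⟩, ⟨c, d⟩⟩
    rw [Fin.prod_univ_four]
    change _ = P (v 0) c * P (v 1) a * P (v 2) d * P (v 3) b * ρ (c, d) (a, b)
    ring
  intro π v
  rw [key v]
  refine (key (v ∘ π)).trans ?_
  refine Fintype.sum_equiv (Equiv.arrowCongr π (Equiv.refl _)) _ _ fun u => ?_
  have h1 := h π (u ∘ π.symm)
  have h2 := Equiv.prod_comp π fun m => P (v m) (u (π.symm m))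
  simp only [Function.comp_apply, Equiv.symm_apply_apply] at h1 h2
  simp only [Equiv.arrowCongr_apply, Function.comp_apply, Equiv.refl_apply]
  rw [h2, h1]

/-- Conjugation by `P ⊗ P` preserves S-separability. -/
theorem SSeparable.kronecker_conj {N : ℕ}
    {ρ : Matrix (Fin N × Fin N) (Fin N × Fin N) ℝ} (h : SSeparable ρ)
    (P : Matrix (Fin N) (Fin N) ℝ) :
    SSeparable ((P ⊗ₖ P) * ρ * (P ⊗ₖ P)ᵀ) := by
  obtain ⟨L, x, rfl⟩ := h
  refine ⟨L, fun t => P *ᵥ x t, ?_⟩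
  rw [Finset.mul_sum, Finset.sum_mul]
  refine Finset.sum_congr rfl fun t _ => ?_
  rw [← kroneckerMap_transpose, ← mul_kronecker_mul, ← mul_kronecker_mul, mul_vecMulVec,
    vecMulVec_mul, vecMul_transpose]

theorem SSeparable.add {N : ℕ} {σ δ : Matrix (Fin N × Fin N) (Fin N × Fin N) ℝ}
    (hσ : SSeparable σ) (hδ : SSeparable δ) : SSeparable (σ + δ) := by
  obtain ⟨L, x, rfl⟩ := hσ
  obtain ⟨M, y, rfl⟩ := hδ
  exact ⟨L + M, Fin.append x y, by simp [Fin.sum_univ_add]⟩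

/-- A matrix annihilating the reduced matrix of a positive semidefinite `σ` annihilates the
first tensor factor of `σ`. -/
theorem kronecker_one_mul_eq_zero {N : ℕ} {σ : Matrix (Fin N × Fin N) (Fin N × Fin N) ℝ}
    (hσ : σ.PosSemidef) {Q : Matrix (Fin N) (Fin N) ℝ} (hQ : Q * reducedMat σ = 0) :
    (Q ⊗ₖ (1 : Matrix (Fin N) (Fin N) ℝ)) * σ = 0 := by
  set K := Q ⊗ₖ (1 : Matrix (Fin N) (Fin N) ℝ) with hK
  have hpos : (K * σ * Kᴴ).PosSemidef := hσ.mul_mul_conjTranspose_same K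
  have entry : ∀ i k, (K * σ * Kᴴ) (i, k) (i, k) = ∑ b, (∑ a, Q i a * σ (a, k) (b, k)) * Q i b := by
    intro i k
    simp [hK, Matrix.mul_apply, Fintype.sum_prod_type, one_apply]
  have hdiag : ∀ i, ∑ k, (K * σ * Kᴴ) (i, k) (i, k) = 0 := by
    intro i
    have h : (Q * reducedMat σ * Qᵀ) i i = 0 := by rw [hQ, Matrix.zero_mul, Matrix.zero_apply]
    simp only [Matrix.mul_apply, reducedMat, of_apply, transpose_apply] at h
    simp only [entry]
    rw [← h]
    rw [Finset.sum_comm]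
    refine Finset.sum_congr rfl fun b _ => ?_
    rw [← Finset.sum_mul, Finset.sum_comm]
    simp only [Finset.mul_sum]
  have htr : (K * σ * Kᴴ).trace = 0 := by
    simp only [Matrix.trace, diag_apply, Fintype.sum_prod_type, hdiag, Finset.sum_const_zero]
  have hzero := hpos.trace_eq_zero_iff.mp htr
  ext ⟨i, k⟩ c
  have hv : (K * σ * Kᴴ) (i, k) (i, k) = 0 := by rw [hzero, Matrix.zero_apply]
  have h2 : σ *ᵥ (K (i, k)) = 0 := by
    rw [← hσ.dotProduct_mulVec_zero_iff]
    rw [← hv, Matrix.mul_assoc]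
    simp only [Matrix.mul_apply, dotProduct, mulVec, star_trivial, conjTranspose_apply]
  have h3 : (σ *ᵥ (K (i, k))) c = 0 := by rw [h2, Pi.zero_apply]
  rw [Matrix.zero_apply, ← h3]
  simp only [Matrix.mul_apply, mulVec, dotProduct]
  refine Finset.sum_congr rfl fun d _ => ?_
  rw [mul_comm, ← hσ.1.apply c d, star_trivial]

/-- A positive semidefinite summand of a completely symmetric matrix is invariant under the
swap of the two tensor factors of its row index. -/
theorem swap_row_of_add {N : ℕ} {σ δ : Matrix (Fin N × Fin N) (Fin N × Fin N) ℝ}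
    (hcs : CompletelySymmetric (σ + δ)) (hσ : σ.PosSemidef) (hδ : δ.PosSemidef)
    (i k : Fin N) (c : Fin N × Fin N) : σ (i, k) c = σ (k, i) c := by
  set w : Fin N × Fin N → ℝ := Pi.single (i, k) 1 - Pi.single (k, i) 1 with hw
  have hρw : (σ + δ) *ᵥ w = 0 := by
    ext ⟨j, l⟩
    have h := hcs (Equiv.swap 1 3) ![j, i, l, k]
    have e0 : Equiv.swap (1 : Fin 4) 3 0 = 0 := by decide
    have e2 : Equiv.swap (1 : Fin 4) 3 2 = 2 := by decide
    simp only [e0, e2, Equiv.swap_apply_left, Equiv.swap_apply_right] at h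
    simp [hw, mulVec_sub, -Matrix.add_apply] at h ⊢
    linarith
  have h1 : star w ⬝ᵥ (σ *ᵥ w) + star w ⬝ᵥ (δ *ᵥ w) = 0 := by
    rw [← dotProduct_add, ← add_mulVec, hρw, dotProduct_zero]
  have h2 : star w ⬝ᵥ (σ *ᵥ w) = 0 := by
    have := hσ.dotProduct_mulVec_nonneg w
    have := hδ.dotProduct_mulVec_nonneg w
    linarith
  have h3 := congrFun ((hσ.dotProduct_mulVec_zero_iff w).mp h2) c
  simp [hw, mulVec_sub] at h3
  rw [← hσ.1.apply, ← hσ.1.apply (k, i) c, star_trivial, star_trivial]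
  linarith

/-- Two independent column spaces are separated by a matrix. -/
theorem exists_mul_eq_self_and_mul_eq_zero {n : Type*} [Fintype n] [DecidableEq n]
    {A B : Matrix n n ℝ} (h : colSpace A ⊓ colSpace B = ⊥) :
    ∃ P : Matrix n n ℝ, P * A = A ∧ P * B = 0 := by
  obtain ⟨C, hBC, hC⟩ := (disjoint_iff.mpr h).symm.exists_isCompl
  refine ⟨LinearMap.toMatrix' ((colSpace A).projection C hC.symm), ?_, ?_⟩
  · apply Matrix.toLin'.injective
    refine LinearMap.ext fun v => ?_
    rw [toLin'_mul, toLin'_toMatrix', LinearMap.comp_apply]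
    exact Submodule.projection_apply_of_mem_left _ ⟨v, rfl⟩
  · apply Matrix.toLin'.injective
    refine LinearMap.ext fun v => ?_
    rw [toLin'_mul, toLin'_toMatrix', LinearMap.comp_apply, map_zero, LinearMap.zero_apply]
    exact (Submodule.projection_apply_eq_zero_iff _).mpr (hBC ⟨v, rfl⟩)

/-- If the reduced matrices of `σ` and `δ` have independent column spaces, then `σ` is obtained
from a completely symmetric `σ + δ` by conjugation with some `P ⊗ P`. -/
theorem exists_eq_kronecker_conj {N : ℕ} {σ δ : Matrix (Fin N × Fin N) (Fin N × Fin N) ℝ}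
    (hcs : CompletelySymmetric (σ + δ)) (hσ : σ.PosSemidef) (hδ : δ.PosSemidef)
    (hinf : colSpace (reducedMat σ) ⊓ colSpace (reducedMat δ) = ⊥) :
    ∃ P : Matrix (Fin N) (Fin N) ℝ, σ = (P ⊗ₖ P) * (σ + δ) * (P ⊗ₖ P)ᵀ := by
  obtain ⟨P, hPσ, hPδ⟩ := exists_mul_eq_self_and_mul_eq_zero hinf
  refine ⟨P, ?_⟩
  have hδ0 : (P ⊗ₖ (1 : Matrix (Fin N) (Fin N) ℝ)) * δ = 0 := kronecker_one_mul_eq_zero hδ hPδ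
  have hl : (P ⊗ₖ (1 : Matrix (Fin N) (Fin N) ℝ)) * σ = σ := by
    have h := kronecker_one_mul_eq_zero hσ (Q := P - 1) (by rw [Matrix.sub_mul, hPσ]; simp)
    rw [← sub_add_cancel P 1, add_kronecker, one_kronecker_one, Matrix.add_mul, h, zero_add,
      Matrix.one_mul]
  have hr : ((1 : Matrix (Fin N) (Fin N) ℝ) ⊗ₖ P) * σ = σ := by
    ext ⟨i, k⟩ c
    have h := congrFun (congrFun hl (k, i)) c
    rw [← swap_row_of_add hcs hσ hδ i k c] at h
    rw [← h]
    simp only [Matrix.mul_apply, Fintype.sum_prod_type, kroneckerMap_apply, one_apply]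
    simp [swap_row_of_add hcs hσ hδ i]
  have hfac : P ⊗ₖ P = ((1 : Matrix (Fin N) (Fin N) ℝ) ⊗ₖ P) *
      (P ⊗ₖ (1 : Matrix (Fin N) (Fin N) ℝ)) := by
    rw [← mul_kronecker_mul, Matrix.one_mul, Matrix.mul_one]
  have hKσ : (P ⊗ₖ P) * σ = σ := by rw [hfac, Matrix.mul_assoc, hl, hr]
  have hKδ : (P ⊗ₖ P) * δ = 0 := by rw [hfac, Matrix.mul_assoc, hδ0, Matrix.mul_zero]
  have hσT : σᵀ = σ := by simpa using hσ.1.eq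
  rw [Matrix.mul_add, hKσ, hKδ, add_zero]
  conv_rhs => rw [← hσT, ← transpose_mul, hKσ, hσT]

/-- If a completely symmetric state `ρ` splits as `σ + δ` with `σ, δ` nonzero positive
semidefinite and the column space of `ρ₁` the direct sum of those of `σ₁` and `δ₁`, then
`σ` and `δ` are completely symmetric, and `ρ` is S-separable iff both `σ` and `δ` are. -/
theorem completelySymmetric_reducible {N : ℕ}
    (ρ σ δ : Matrix (Fin N × Fin N) (Fin N × Fin N) ℝ)
    (hcs : CompletelySymmetric ρ) (hpsd : ρ.PosSemidef) (htr : ρ.trace = 1)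
    (hσ : σ.PosSemidef) (hδ : δ.PosSemidef) (hσ0 : σ ≠ 0) (hδ0 : δ ≠ 0)
    (hsum : ρ = σ + δ)
    (hsup : colSpace (reducedMat ρ) = colSpace (reducedMat σ) ⊔ colSpace (reducedMat δ))
    (hinf : colSpace (reducedMat σ) ⊓ colSpace (reducedMat δ) = ⊥) :
    CompletelySymmetric σ ∧ CompletelySymmetric δ ∧
      (SSeparable ρ ↔ SSeparable σ ∧ SSeparable δ) := by
  subst hsum
  obtain ⟨P, hP⟩ := exists_eq_kronecker_conj hcs hσ hδ hinf
  obtain ⟨Q, hQ⟩ := exists_eq_kronecker_conj (add_comm σ δ ▸ hcs) hδ hσ (by rwa [inf_comm])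
  rw [add_comm δ σ] at hQ
  refine ⟨?_, ?_, fun h => ⟨?_, ?_⟩, fun h => h.1.add h.2⟩
  · rw [hP]; exact hcs.kronecker_conj P
  · rw [hQ]; exact hcs.kronecker_conj Q
  · rw [hP]; exact h.kronecker_conj P
  · rw [hQ]; exact h.kronecker_conj Q
end

section
/- Every completely symmetric state ρ on ℝ^N ⊗ ℝ^N with rank(ρ) ≤ 4 that is separable over ℝ is S-separable. -/
open Matrix
open Kronecker
open scoped BigOperators

/-- A completely symmetric matrix is invariant under exchanging the two row indices. -/
theorem CompletelySymmetric.swap_row {N : ℕ}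
    {ρ : Matrix (Fin N × Fin N) (Fin N × Fin N) ℝ} (h : CompletelySymmetric ρ)
    (i k : Fin N) (q : Fin N × Fin N) : ρ (k, i) q = ρ (i, k) q := by
  simpa [Equiv.swap_apply_def] using h (Equiv.swap 0 2) ![i, q.1, k, q.2]

/-- The product vectors of any separable decomposition of a completely symmetric matrix are
symmetric. -/
theorem CompletelySymmetric.mul_eq_mul_of_eq_sum {N L : ℕ}
    {ρ : Matrix (Fin N × Fin N) (Fin N × Fin N) ℝ} (h : CompletelySymmetric ρ)
    {x y : Fin L → Fin N → ℝ}
    (hρ : ρ = ∑ t, vecMulVec (x t) (x t) ⊗ₖ vecMulVec (y t) (y t)) (t : Fin L) (i k : Fin N) :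
    x t i * y t k = x t k * y t i := by
  have entry : ∀ p q : Fin N × Fin N,
      ρ p q = ∑ t, x t p.1 * x t q.1 * (y t p.2 * y t q.2) := fun p q => by
    simp [hρ, Matrix.sum_apply, kroneckerMap_apply, vecMulVec_apply]
  have hsum : ∑ t, (x t i * y t k - x t k * y t i) ^ 2 = 0 := by
    calc ∑ t, (x t i * y t k - x t k * y t i) ^ 2
        = ρ (i, k) (i, k) - ρ (k, i) (i, k) + (ρ (k, i) (k, i) - ρ (i, k) (k, i)) := by
          simp only [entry, ← Finset.sum_sub_distrib, ← Finset.sum_add_distrib]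
          exact Finset.sum_congr rfl fun t _ => by ring
      _ = 0 := by simp [h.swap_row i k]
  have hterm := (Finset.sum_eq_zero_iff_of_nonneg fun t _ => sq_nonneg _).1 hsum t
    (Finset.mem_univ t)
  exact sub_eq_zero.1 (pow_eq_zero_iff two_ne_zero |>.1 hterm)

/-- If `x ⊗ y` is symmetric, then `(x xᵀ) ⊗ (y yᵀ)` has the form `(z zᵀ) ⊗ (z zᵀ)`. -/
theorem exists_vecMulVec_kronecker_eq_self {n : Type*} (x y : n → ℝ)
    (h : ∀ i k, x i * y k = x k * y i) :
    ∃ z : n → ℝ, vecMulVec x x ⊗ₖ vecMulVec y y = vecMulVec z z ⊗ₖ vecMulVec z z := by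
  by_cases hx : x = 0
  · exact ⟨0, by simp [hx]⟩
  obtain ⟨a, ha⟩ := Function.ne_iff.1 hx
  have hxa : x a ≠ 0 := ha
  obtain ⟨c, rfl⟩ : ∃ c : ℝ, y = c • x := ⟨y a / x a, by
    ext i
    simp only [Pi.smul_apply, smul_eq_mul]
    field_simp
    linarith [h a i]⟩
  refine ⟨√|c| • x, ?_⟩
  have hc : √|c| ^ 4 = c ^ 2 := by
    rw [show √|c| ^ 4 = (√|c| ^ 2) ^ 2 by ring, Real.sq_sqrt (abs_nonneg c), sq_abs]
  ext ⟨i, k⟩ ⟨j, l⟩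
  simp only [kroneckerMap_apply, vecMulVec_apply, Pi.smul_apply, smul_eq_mul]
  linear_combination -(x i * x j * x k * x l) * hc

/-- Every separable completely symmetric state of rank at most 4 is S-separable. -/
theorem completelySymmetric_rank_le_four_sSeparable {N : ℕ}
    (ρ : Matrix (Fin N × Fin N) (Fin N × Fin N) ℝ)
    (hcs : CompletelySymmetric ρ) (hpsd : ρ.PosSemidef) (htr : ρ.trace = 1)
    (hrank : ρ.rank ≤ 4) (hsep : SeparableR ρ) :
    SSeparable ρ := by
  obtain ⟨L, x, y, hρ⟩ := hsep
  choose z hz using fun t =>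
    exists_vecMulVec_kronecker_eq_self (x t) (y t) (hcs.mul_eq_mul_of_eq_sum hρ t)
  exact ⟨L, z, hρ.trans (Finset.sum_congr rfl fun t _ => hz t)⟩
end
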